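/- arXiv:2409.16105 — 8 statements merged into one kernel-verified Lean document; each statement's English description precedes it below -/
import Mathlib

section
/- Let L be a map from the space of holomorphic functions on 𝔸 to ℂ which is not identically zero, ℂ-linear, multiplicative (L(fg) = L(f)L(g) for all holomorphic f, g on 𝔸), and continuous with respect to the topology of uniform convergence on compact subsets of 𝔸. Then there exists a point z₀ ∈ 𝔸 such that L(f) = f(z₀) for every holomorphic function f on 𝔸. -/
open Complex Set Filter Topology

/-- The open annulus `{z : 1/R < |z| < R}`, symmetric with respect to the unit circle. -/
def ann (R : ℝ) : Set ℂ := {z : ℂ | 1 / R < ‖z‖ ∧ ‖z‖ < R}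

/-- Every nonzero, linear, multiplicative, continuous functional on `Hol(𝔸)` is a point
evaluation at some point of the annulus. -/
theorem stmt0 (R : ℝ) (hR : 1 < R) (L : (ℂ → ℂ) → ℂ)
    (hnz : ∃ f : ℂ → ℂ, DifferentiableOn ℂ f (ann R) ∧ L f ≠ 0)
    (hadd : ∀ f g : ℂ → ℂ, DifferentiableOn ℂ f (ann R) → DifferentiableOn ℂ g (ann R) →
      L (f + g) = L f + L g)
    (hsmul : ∀ (c : ℂ) (f : ℂ → ℂ), DifferentiableOn ℂ f (ann R) → L (c • f) = c * L f)
    (hmul : ∀ f g : ℂ → ℂ, DifferentiableOn ℂ f (ann R) → DifferentiableOn ℂ g (ann R) →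
      L (f * g) = L f * L g)
    (hcont : ∀ (F : ℕ → ℂ → ℂ) (f : ℂ → ℂ), (∀ n, DifferentiableOn ℂ (F n) (ann R)) →
      DifferentiableOn ℂ f (ann R) → TendstoLocallyUniformlyOn F f atTop (ann R) →
      Tendsto (fun n => L (F n)) atTop (𝓝 (L f))) :
    ∃ z₀ ∈ ann R, ∀ f : ℂ → ℂ, DifferentiableOn ℂ f (ann R) → L f = f z₀ := by
  have hopen : IsOpen (ann R) :=
    (isOpen_lt continuous_const continuous_norm).inter
      (isOpen_lt continuous_norm continuous_const)
  have hcongr : ∀ f g : ℂ → ℂ, DifferentiableOn ℂ f (ann R) → EqOn f g (ann R) →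
      L f = L g := by
    intro f g hf hfg
    refine tendsto_nhds_unique tendsto_const_nhds
      (hcont (fun _ => f) g (fun _ => hf) (hf.congr fun z hz => (hfg hz).symm) ?_)
    intro u hu z _
    refine ⟨ann R, self_mem_nhdsWithin, Eventually.of_forall fun _ y hy => ?_⟩
    rw [← hfg hy]
    exact refl_mem_uniformity hu
  have hone : L 1 = 1 := by
    obtain ⟨f, hf, hLf⟩ := hnz
    have h := hmul 1 f (differentiableOn_const 1) hf
    rw [one_mul] at h
    exact mul_right_cancel₀ hLf (by rw [← h, one_mul])
  have hconst : ∀ c : ℂ, L (c • 1) = c := fun c => by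
    rw [hsmul c 1 (differentiableOn_const 1), hone, mul_one]
  have hd1 : ∀ c : ℂ, DifferentiableOn ℂ (c • (1 : ℂ → ℂ)) (ann R) := fun c =>
    (differentiableOn_const (1 : ℂ)).const_smul c
  -- A multiple of `z - L id` is annihilated, so its other factor need not be known.
  have hdiv : ∀ (f g : ℂ → ℂ) (c : ℂ), DifferentiableOn ℂ f (ann R) →
      DifferentiableOn ℂ g (ann R) → (∀ z ∈ ann R, f z = c + (z - L id) * g z) → L f = c := by
    intro f g c hf hg h
    have hlin : DifferentiableOn ℂ (id + (-L id) • (1 : ℂ → ℂ)) (ann R) :=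
      differentiableOn_id.add (hd1 _)
    rw [hcongr f (c • 1 + (id + (-L id) • 1) * g) hf fun z hz => by
        simp [h z hz, sub_eq_add_neg],
      hadd _ _ (hd1 c) (hlin.mul hg), hmul _ _ hlin hg,
      hadd _ _ differentiableOn_id (hd1 _), hconst, hconst]
    ring
  have hmem : L id ∈ ann R := by
    by_contra hz
    have hne : ∀ z ∈ ann R, z - L id ≠ 0 := fun z hzR h => hz (sub_eq_zero.mp h ▸ hzR)
    have h := hdiv 1 (fun z => (z - L id)⁻¹) 0 (differentiableOn_const 1)
      ((differentiableOn_id.sub_const _).inv hne) fun z hzR => by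
        simp [mul_inv_cancel₀ (hne z hzR)]
    exact one_ne_zero (hone.symm.trans h)
  refine ⟨L id, hmem, fun f hf => hdiv f (dslope f (L id)) _ hf
    ((Complex.differentiableOn_dslope (hopen.mem_nhds hmem)).mpr hf) fun z _ => ?_⟩
  rw [← smul_eq_mul, sub_smul_dslope]
  ring
end

section
/- Let T be a ℂ-linear map from the space of holomorphic functions on 𝔸 to itself which is continuous with respect to the topology of uniform convergence on compact subsets of 𝔸. Then the following are equivalent: (1) T is a composition operator, i.e. there exists a holomorphic map φ : 𝔸 → 𝔸 such that (Tf)(z) = f(φ(z)) for every holomorphic f on 𝔸 and every z ∈ 𝔸; (2) (Te₁)(z) ≠ 0 for every z ∈ 𝔸 and for every integer n ∈ ℤ and every z ∈ 𝔸 one has (Teₙ)(z) = ((Te₁)(z))ⁿ, where eₙ denotes the function z ↦ zⁿ. -/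
open Complex Set Filter Topology

open scoped Real

/-- The `n`-th Laurent coefficient of `f`, computed on the circle of radius `r` around `0`. -/
noncomputable def laurentCoeff (f : ℂ → ℂ) (r : ℝ) (n : ℤ) : ℂ :=
  (2 * π * I : ℂ)⁻¹ • ∮ z in C(0, r), (z - 0)⁻¹ • (z ^ (-n) * f z)

/-- Restriction of `f` to the circle of radius `r` around `0`, as a function on `ℝ / 2πℤ`. -/
noncomputable def circleRestrict (f : ℂ → ℂ) (r : ℝ) (x : AddCircle (2 * π)) : ℂ :=
  f (r * AddCircle.toCircle x)

theorem circleRestrict_coe (f : ℂ → ℂ) (r θ : ℝ) :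
    circleRestrict f r (θ : AddCircle (2 * π)) = f (circleMap 0 r θ) := by
  simp [circleRestrict, circleMap, AddCircle.toCircle_apply_mk]

instance fact_zero_lt_two_mul_pi : Fact (0 < 2 * π) := ⟨Real.two_pi_pos⟩

theorem fourierCoeff_circleRestrict (f : ℂ → ℂ) {r : ℝ} (hr : 0 < r) (n : ℤ) :
    fourierCoeff (circleRestrict f r) n = laurentCoeff f r n * (r : ℂ) ^ n := by
  have hr' : (r : ℂ) ≠ 0 := by exact_mod_cast hr.ne'
  have hπ : (π : ℂ) ≠ 0 := by exact_mod_cast Real.pi_ne_zero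
  have key : (∮ z in C(0, r), (z - 0)⁻¹ • (z ^ (-n) * f z)) =
      I * (r : ℂ) ^ (-n) * ∫ θ in (0 : ℝ)..2 * π,
        fourier (T := 2 * π) (-n) (θ : AddCircle (2 * π)) • circleRestrict f r θ := by
    rw [circleIntegral, ← intervalIntegral.integral_const_mul]
    refine intervalIntegral.integral_congr fun θ _ => ?_
    have hc : circleMap 0 r θ ≠ 0 := circleMap_ne_center hr.ne'
    have hpow : (circleMap 0 r θ) ^ (-n) =
        (r : ℂ) ^ (-n) * fourier (T := 2 * π) (-n) (θ : AddCircle (2 * π)) := by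
      rw [fourier_coe_apply, circleMap_zero, mul_zpow, ← Complex.exp_int_mul]
      congr 2
      push_cast
      field_simp
    simp only [deriv_circleMap, sub_zero, smul_eq_mul, circleRestrict_coe, hpow]
    field_simp
  rw [fourierCoeff_eq_intervalIntegral _ _ 0, laurentCoeff, key, zero_add, zpow_neg]
  simp only [smul_eq_mul, Complex.real_smul]
  push_cast
  field_simp

section Annulus

variable {a b : ℝ} {f : ℂ → ℂ}

theorem isOpen_annulus (a b : ℝ) : IsOpen {z : ℂ | a < ‖z‖ ∧ ‖z‖ < b} :=
  (isOpen_lt continuous_const continuous_norm).inter (isOpen_lt continuous_norm continuous_const)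

theorem laurentCoeff_eq_of_le (ha : 0 ≤ a) (hf : DifferentiableOn ℂ f {z | a < ‖z‖ ∧ ‖z‖ < b})
    {r s : ℝ} (har : a < r) (hrs : r ≤ s) (hsb : s < b) (n : ℤ) :
    laurentCoeff f s n = laurentCoeff f r n := by
  have hd : DifferentiableOn ℂ (fun z => z ^ (-n) * f z) {z | a < ‖z‖ ∧ ‖z‖ < b} := fun z hz =>
    (differentiableAt_zpow.2 (.inl (norm_pos_iff.1 (ha.trans_lt hz.1)))).differentiableWithinAt.mul
      (hf z hz)
  unfold laurentCoeff
  congr 1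
  refine Complex.circleIntegral_sub_center_inv_smul_eq_of_differentiable_on_annulus_off_countable
    (ha.trans_lt har) hrs countable_empty (hd.continuousOn.mono ?_) ?_
  · intro z hz
    simp only [Set.mem_sdiff, mem_closedBall_zero_iff, mem_ball_zero_iff, not_lt] at hz
    exact ⟨har.trans_le hz.2, hz.1.trans_lt hsb⟩
  · intro z hz
    simp only [Set.mem_sdiff, mem_closedBall_zero_iff, mem_ball_zero_iff, not_le] at hz
    exact hd.differentiableAt
      ((isOpen_annulus a b).mem_nhds ⟨har.trans hz.1.2, hz.1.1.trans hsb⟩)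

theorem laurentCoeff_eq (ha : 0 ≤ a) (hf : DifferentiableOn ℂ f {z | a < ‖z‖ ∧ ‖z‖ < b})
    {r s : ℝ} (hr : r ∈ Ioo a b) (hs : s ∈ Ioo a b) (n : ℤ) :
    laurentCoeff f s n = laurentCoeff f r n := by
  rcases le_total r s with h | h
  · exact laurentCoeff_eq_of_le ha hf hr.1 h hs.2 n
  · exact (laurentCoeff_eq_of_le ha hf hs.1 h hr.2 n).symm

theorem continuous_circleRestrict (ha : 0 ≤ a)
    (hf : ContinuousOn f {z | a < ‖z‖ ∧ ‖z‖ < b}) {r : ℝ} (hr : r ∈ Ioo a b) :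
    Continuous (circleRestrict f r) := by
  refine hf.comp_continuous (continuous_const.mul
    (continuous_subtype_val.comp AddCircle.continuous_toCircle)) fun x => ?_
  have : ‖(r : ℂ) * AddCircle.toCircle x‖ = r := by
    simp [Circle.norm_coe, abs_of_pos (ha.trans_lt hr.1)]
  rw [mem_ofPred_eq, this]
  exact hr

theorem exists_norm_laurentCoeff_mul_zpow_le (ha : 0 ≤ a)
    (hf : ContinuousOn f {z | a < ‖z‖ ∧ ‖z‖ < b}) {r : ℝ} (hr : r ∈ Ioo a b) :
    ∃ M : ℝ, ∀ n : ℤ, ‖laurentCoeff f r n‖ * r ^ n ≤ M := by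
  have hr0 : 0 < r := ha.trans_lt hr.1
  have hg := continuous_circleRestrict ha hf hr
  obtain ⟨M, hM⟩ := isCompact_univ.exists_bound_of_continuousOn hg.continuousOn
  refine ⟨M, fun n => ?_⟩
  have h : ‖laurentCoeff f r n‖ * r ^ n = ‖fourierCoeff (circleRestrict f r) n‖ := by
    rw [fourierCoeff_circleRestrict f hr0, norm_mul, norm_zpow, Complex.norm_real,
      Real.norm_of_nonneg hr0.le]
  rw [h, fourierCoeff]
  refine (MeasureTheory.norm_integral_le_of_norm_le_const (C := M)
    (.of_forall fun x => ?_)).trans (by simp)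
  rw [norm_smul, fourier_apply, Circle.norm_coe, one_mul]
  exact hM x (mem_univ x)

theorem summable_norm_laurentCoeff_mul_zpow (ha : 0 ≤ a)
    (hf : DifferentiableOn ℂ f {z | a < ‖z‖ ∧ ‖z‖ < b}) {r : ℝ} (hr : r ∈ Ioo a b) :
    Summable fun n : ℤ => ‖laurentCoeff f r n‖ * r ^ n := by
  have hr0 : 0 < r := ha.trans_lt hr.1
  obtain ⟨s, hrs, hsb⟩ := exists_between hr.2
  obtain ⟨t, hat, htr⟩ := exists_between hr.1
  have hs0 : 0 < s := hr0.trans hrs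
  have ht0 : 0 < t := ha.trans_lt hat
  have hs : s ∈ Ioo a b := ⟨hr.1.trans hrs, hsb⟩
  have ht : t ∈ Ioo a b := ⟨hat, htr.trans hr.2⟩
  obtain ⟨M, hM⟩ := exists_norm_laurentCoeff_mul_zpow_le ha hf.continuousOn hs
  obtain ⟨N, hN⟩ := exists_norm_laurentCoeff_mul_zpow_le ha hf.continuousOn ht
  refine Summable.of_nat_of_neg ?_ ?_
  · refine .of_nonneg_of_le (fun n => by positivity) (fun n => ?_)
      ((summable_geometric_of_lt_one (by positivity) ((div_lt_one hs0).2 hrs)).mul_left M)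
    have := mul_le_mul_of_nonneg_right (hM n) (by positivity : 0 ≤ (r / s) ^ n)
    rw [laurentCoeff_eq ha hf hr hs] at this
    refine le_trans (le_of_eq ?_) this
    simp only [zpow_natCast, div_pow]
    field_simp
  · refine .of_nonneg_of_le (fun n => by positivity) (fun n => ?_)
      ((summable_geometric_of_lt_one (by positivity) ((div_lt_one hr0).2 htr)).mul_left N)
    have := mul_le_mul_of_nonneg_right (hN (-n)) (by positivity : 0 ≤ (t / r) ^ n)
    rw [laurentCoeff_eq ha hf hr ht] at this
    refine le_trans (le_of_eq ?_) this
    simp only [zpow_neg, zpow_natCast, div_pow]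
    field_simp

/-- A holomorphic function on an annulus is the sum of its Laurent series. -/
theorem exists_hasSum_laurent (ha : 0 ≤ a)
    (hf : DifferentiableOn ℂ f {z | a < ‖z‖ ∧ ‖z‖ < b}) :
    ∃ c : ℤ → ℂ, ∀ z : ℂ, a < ‖z‖ ∧ ‖z‖ < b → HasSum (fun n : ℤ => c n * z ^ n) (f z) := by
  by_cases hab : a < b
  swap
  · exact ⟨0, fun z hz => absurd (hz.1.trans hz.2) hab⟩
  obtain ⟨s, hs⟩ : (Ioo a b).Nonempty := nonempty_Ioo.2 hab
  refine ⟨laurentCoeff f s, fun z hz => ?_⟩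
  have hz0 : 0 < ‖z‖ := ha.trans_lt hz.1
  let g : C(AddCircle (2 * π), ℂ) :=
    ⟨circleRestrict f ‖z‖, continuous_circleRestrict ha hf.continuousOn hz⟩
  have hcoeff : ∀ n, fourierCoeff g n = laurentCoeff f s n * (‖z‖ : ℂ) ^ n := fun n => by
    rw [laurentCoeff_eq ha hf hz hs]
    exact fourierCoeff_circleRestrict f hz0 n
  have hsum : Summable (fourierCoeff g) := by
    refine .of_norm ((summable_norm_laurentCoeff_mul_zpow ha hf hz).congr fun n => ?_)
    rw [hcoeff, laurentCoeff_eq ha hf hz hs, norm_mul, norm_zpow, Complex.norm_real, norm_norm]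
  have hcirc : circleMap 0 ‖z‖ (arg z) = z := by simp [circleMap]
  have hval : g (arg z : AddCircle (2 * π)) = f z := by
    change circleRestrict f ‖z‖ _ = _
    rw [circleRestrict_coe, hcirc]
  have h := has_pointwise_sum_fourier_series_of_summable hsum (arg z : AddCircle (2 * π))
  rw [hval] at h
  refine h.congr_fun fun n => ?_
  have hπ : (π : ℂ) ≠ 0 := by exact_mod_cast Real.pi_ne_zero
  rw [hcoeff, smul_eq_mul, mul_assoc, fourier_coe_apply]
  congr 1
  nth_rw 1 [← hcirc]
  rw [circleMap_zero, mul_zpow, ← Complex.exp_int_mul]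
  congr 2
  push_cast
  field_simp

/-- If a Laurent series converges pointwise on an annulus, then its symmetric partial sums
converge locally uniformly there. -/
theorem tendstoLocallyUniformlyOn_laurent (ha : 0 ≤ a) {c : ℤ → ℂ}
    (hc : ∀ z : ℂ, a < ‖z‖ ∧ ‖z‖ < b → HasSum (fun n : ℤ => c n * z ^ n) (f z)) :
    TendstoLocallyUniformlyOn
      (fun m : ℕ => ∑ n ∈ Finset.Icc (-m : ℤ) m, c n • fun z : ℂ => z ^ n) f atTop
      {z | a < ‖z‖ ∧ ‖z‖ < b} := by
  have hsum : ∀ r ∈ Ioo a b, Summable fun n : ℤ => ‖c n‖ * r ^ n := fun r hr => by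
    have hr0 : 0 < r := ha.trans_lt hr.1
    have hn : ‖(r : ℂ)‖ = r := by rw [Complex.norm_real, Real.norm_of_nonneg hr0.le]
    refine (hc r (by rwa [hn])).summable.norm.congr fun n => ?_
    rw [norm_mul, norm_zpow, hn]
  refine tendstoLocallyUniformlyOn_of_forall_exists_nhds fun z hz => ?_
  obtain ⟨t, hzt, htb⟩ := exists_between hz.2
  obtain ⟨s, has, hsz⟩ := exists_between hz.1
  have hs0 : 0 < s := ha.trans_lt has
  have hst : s < t := hsz.trans hzt
  refine ⟨{w | s < ‖w‖ ∧ ‖w‖ < t},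
    mem_nhdsWithin_of_mem_nhds ((isOpen_annulus s t).mem_nhds ⟨hsz, hzt⟩), ?_⟩
  have hu := (hsum s ⟨has, hst.trans htb⟩).add (hsum t ⟨has.trans hst, htb⟩)
  have hU := tendstoUniformlyOn_tsum (f := fun (n : ℤ) (w : ℂ) => c n * w ^ n) hu
    (s := {w | s < ‖w‖ ∧ ‖w‖ < t}) fun n w hw => by
      have hw0 : 0 < ‖w‖ := hs0.trans hw.1
      rw [norm_mul, norm_zpow, ← mul_add]
      gcongr
      rcases le_total 0 n with hn | hn
      · exact (zpow_le_zpow_left₀ hn hw0.le hw.2.le).trans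
          (le_add_of_nonneg_left (zpow_nonneg hs0.le n))
      · refine le_trans ?_ (le_add_of_nonneg_right (zpow_nonneg (hs0.trans hst).le n))
        obtain ⟨k, rfl⟩ := Int.exists_eq_neg_ofNat hn
        simp only [zpow_neg, zpow_natCast]
        gcongr
        exact hw.1.le
  have hU' : TendstoUniformlyOn
      (fun m : ℕ => ∑ n ∈ Finset.Icc (-m : ℤ) m, c n • fun z : ℂ => z ^ n)
      (fun w => ∑' n : ℤ, c n * w ^ n) atTop {w | s < ‖w‖ ∧ ‖w‖ < t} := by
    intro v hv
    filter_upwards [Finset.tendsto_Icc_neg.eventually (hU v hv)] with m hm w hw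
    simpa using hm w hw
  exact hU'.congr_right fun w hw => (hc w ⟨has.trans hw.1, hw.2.trans htb⟩).tsum_eq

end Annulus

/-- If `‖g‖ < 1` on `U`, the powers of `g` tend to `0` locally uniformly on `U`. -/
theorem tendstoLocallyUniformlyOn_pow_zero {g : ℂ → ℂ} {U : Set ℂ} (hg : ContinuousOn g U)
    (hlt : ∀ z ∈ U, ‖g z‖ < 1) :
    TendstoLocallyUniformlyOn (fun (m : ℕ) w => g w ^ m) 0 atTop U := by
  refine tendstoLocallyUniformlyOn_of_forall_exists_nhds fun z hz => ?_
  obtain ⟨q, hzq, hq1⟩ := exists_between (hlt z hz)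
  refine ⟨{w | ‖g w‖ < q}, (hg z hz).norm.eventually_lt_const hzq, ?_⟩
  rw [Metric.tendstoUniformlyOn_iff]
  intro ε hε
  have hq0 : 0 ≤ q := (norm_nonneg _).trans hzq.le
  filter_upwards [(tendsto_pow_atTop_nhds_zero_of_lt_one hq0 hq1).eventually_lt_const hε]
    with m hm w hw
  rw [Pi.zero_apply, dist_zero_left, norm_pow]
  exact (pow_le_pow_left₀ (norm_nonneg _) (le_of_lt hw) m).trans_lt hm

theorem differentiableOn_zpow_ann {R : ℝ} (hR : 0 < R) (n : ℤ) :
    DifferentiableOn ℂ (fun z : ℂ => z ^ n) (ann R) := fun _ hz =>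
  (differentiableAt_zpow.2 (.inl (norm_pos_iff.1
    ((one_div_pos.2 hR).trans hz.1)))).differentiableWithinAt

/-- Algebraic characterisation of composition operators on `Hol(𝔸)`: a continuous linear
operator `T` is a composition operator iff `T e₁` is nonvanishing on `𝔸` and
`T eₙ = (T e₁)ⁿ` for every `n ∈ ℤ`, where `eₙ(z) = zⁿ`. -/
theorem stmt1 (R : ℝ) (hR : 1 < R) (T : (ℂ → ℂ) → ℂ → ℂ)
    (hhol : ∀ f : ℂ → ℂ, DifferentiableOn ℂ f (ann R) → DifferentiableOn ℂ (T f) (ann R))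
    (hadd : ∀ f g : ℂ → ℂ, DifferentiableOn ℂ f (ann R) → DifferentiableOn ℂ g (ann R) →
      ∀ z ∈ ann R, T (f + g) z = T f z + T g z)
    (hsmul : ∀ (c : ℂ) (f : ℂ → ℂ), DifferentiableOn ℂ f (ann R) →
      ∀ z ∈ ann R, T (c • f) z = c * T f z)
    (hcont : ∀ (F : ℕ → ℂ → ℂ) (f : ℂ → ℂ), (∀ m, DifferentiableOn ℂ (F m) (ann R)) →
      DifferentiableOn ℂ f (ann R) → TendstoLocallyUniformlyOn F f atTop (ann R) →
      TendstoLocallyUniformlyOn (fun m => T (F m)) (T f) atTop (ann R)) :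
    (∃ φ : ℂ → ℂ, DifferentiableOn ℂ φ (ann R) ∧ Set.MapsTo φ (ann R) (ann R) ∧
        ∀ f : ℂ → ℂ, DifferentiableOn ℂ f (ann R) → ∀ z ∈ ann R, T f z = f (φ z)) ↔
      ((∀ z ∈ ann R, T (fun w => w) z ≠ 0) ∧
        ∀ n : ℤ, ∀ z ∈ ann R, T (fun w => w ^ n) z = (T (fun w => w) z) ^ n) := by
  have hR0 : 0 < R := one_pos.trans hR
  have hpow := differentiableOn_zpow_ann hR0
  have hid : DifferentiableOn ℂ (fun w : ℂ => w) (ann R) := differentiableOn_id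
  constructor
  · rintro ⟨φ, -, hmaps, hT⟩
    refine ⟨fun z hz => ?_, fun n z hz => ?_⟩
    · rw [hT _ hid z hz]
      exact norm_pos_iff.1 ((one_div_pos.2 hR0).trans (hmaps hz).1)
    · rw [hT _ (hpow n) z hz, hT _ hid z hz]
  · rintro ⟨hne, hTpow⟩
    have hbound : ∀ (k : ℤ) (C : ℂ), (∀ z ∈ ann R, ‖C * z ^ k‖ < 1) → ∀ z ∈ ann R,
        C * T (fun w => w) z ^ k ≠ 1 := by
      intro k C hC z hz h1
      have hlim := hcont (fun m w => (C * w ^ k) ^ m) 0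
        (fun m => ((hpow k).const_mul C).pow m) (differentiableOn_const 0)
        (tendstoLocallyUniformlyOn_pow_zero ((hpow k).const_mul C).continuousOn hC)
      have hval : ∀ m : ℕ, T (fun w => (C * w ^ k) ^ m) z = 1 := fun m => by
        have he : (fun w : ℂ => (C * w ^ k) ^ m) = C ^ m • fun w : ℂ => w ^ (k * m) := by
          ext w
          simp [mul_pow, zpow_mul]
        rw [he, hsmul _ _ (hpow _) z hz, hTpow _ z hz, zpow_mul, zpow_natCast, ← mul_pow, h1,
          one_pow]
      have hzero : T 0 z = 0 := by
        simpa using hsmul 0 0 (differentiableOn_const 0) z hz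
      have ht := hlim.tendsto_at hz
      simp only [hval, hzero] at ht
      exact one_ne_zero (tendsto_nhds_unique tendsto_const_nhds ht)
    have hmaps : MapsTo (T fun w => w) (ann R) (ann R) := by
      intro z hz
      have hp : 0 < ‖T (fun w => w) z‖ := norm_pos_iff.2 (hne z hz)
      constructor
      · by_contra! hle
        refine hbound (-1) (T (fun w => w) z) (fun w hw => ?_) z hz (by simp [hne z hz])
        rw [zpow_neg_one, norm_mul, norm_inv, ← div_eq_mul_inv,
          div_lt_one ((one_div_pos.2 hR0).trans hw.1)]
        exact hle.trans_lt hw.1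
      · by_contra! hle
        refine hbound 1 (T (fun w => w) z)⁻¹ (fun w hw => ?_) z hz (by simp [hne z hz])
        rw [zpow_one, norm_mul, norm_inv, inv_mul_lt_one₀ hp]
        exact hw.2.trans_le hle
    refine ⟨T fun w => w, hhol _ hid, hmaps, fun f hf z hz => ?_⟩
    have ha : 0 ≤ 1 / R := (one_div_pos.2 hR0).le
    obtain ⟨c, hc⟩ := exists_hasSum_laurent ha hf
    have hdiff : ∀ s : Finset ℤ,
        DifferentiableOn ℂ (∑ n ∈ s, c n • fun w : ℂ => w ^ n) (ann R) := fun s =>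
      DifferentiableOn.sum fun n _ => (hpow n).const_smul (c n)
    have hTsum : ∀ s : Finset ℤ, T (∑ n ∈ s, c n • fun w : ℂ => w ^ n) z =
        (∑ n ∈ s, c n • fun w : ℂ => w ^ n) (T (fun w => w) z) := by
      intro s
      induction s using Finset.induction_on with
      | empty => simpa using hsmul 0 0 (differentiableOn_const 0) z hz
      | insert n s hn ih =>
        rw [Finset.sum_insert hn, hadd _ _ ((hpow n).const_smul (c n)) (hdiff s) z hz, ih,
          hsmul _ _ (hpow n) z hz, hTpow n z hz]
        simp
    have hlu := tendstoLocallyUniformlyOn_laurent ha hc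
    have hl := (hcont _ f (fun m => hdiff _) hf hlu).tendsto_at hz
    simp only [hTsum] at hl
    exact tendsto_nhds_unique hl (hlu.tendsto_at (hmaps hz))
end

section
/- Let f be holomorphic on 𝔸 and not identically zero, and for r ∈ (1/R, R) set M(r) = sup{|f(z)| : |z| = r}. Then for all radii 1/R < r₁ < r₂ < r₃ < R one has log(r₃/r₁)·log M(r₂) ≤ log(r₃/r₂)·log M(r₁) + log(r₂/r₁)·log M(r₃); that is, the function r ↦ log M(r) is a convex function of log r. -/
open Complex Set

open Filter Topology in
/-- A holomorphic function on a vertical strip that vanishes on a vertical line inside the strip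
vanishes on the whole strip. -/
theorem eqOn_zero_verticalStrip_of_eqOn_line {g : ℂ → ℂ} {a b s : ℝ}
    (hg : DifferentiableOn ℂ g (HadamardThreeLines.verticalStrip a b)) (hs : s ∈ Ioo a b)
    (hz : ∀ w : ℂ, w.re = s → g w = 0) : EqOn g 0 (HadamardThreeLines.verticalStrip a b) := by
  have hopen : IsOpen (HadamardThreeLines.verticalStrip a b) := isOpen_Ioo.preimage continuous_re
  have hconv : Convex ℝ (HadamardThreeLines.verticalStrip a b) :=
    (convex_Ioo a b).linear_preimage reLm
  refine (hg.analyticOnNhd hopen).eqOn_zero_of_preconnected_of_frequently_eq_zero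
    hconv.isPreconnected (z₀ := (s : ℂ)) (by simpa [HadamardThreeLines.verticalStrip] using hs) ?_
  have ht : Tendsto (fun t : ℝ => (s : ℂ) + t * I) (𝓝[≠] 0) (𝓝[≠] (s : ℂ)) := by
    refine tendsto_nhdsWithin_iff.2 ⟨?_, ?_⟩
    · have hc : Continuous (fun t : ℝ => (s : ℂ) + t * I) := by fun_prop
      simpa using (hc.tendsto 0).mono_left nhdsWithin_le_nhds
    · filter_upwards [self_mem_nhdsWithin] with t ht
      simpa using ht
  exact ht.frequently (Eventually.frequently (.of_forall fun t => hz _ (by simp)))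

theorem exp_mem_ann {R : ℝ} (hR : 1 < R) {w : ℂ}
    (hw : w ∈ HadamardThreeLines.verticalStrip (Real.log (1 / R)) (Real.log R)) :
    exp w ∈ ann R := by
  have hR0 : 0 < R := by linarith
  obtain ⟨h1, h2⟩ := hw
  exact ⟨by rw [norm_exp]; exact (Real.log_lt_iff_lt_exp (by positivity)).1 h1,
    by rw [norm_exp]; exact (Real.lt_log_iff_exp_lt hR0).1 h2⟩

theorem sphere_subset_ann {R r : ℝ} (h1 : 1 / R < r) (h2 : r < R) :
    {z : ℂ | ‖z‖ = r} ⊆ ann R := by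
  rintro z rfl
  exact ⟨h1, h2⟩

theorem bddAbove_norm_image_circle {R r : ℝ} {f : ℂ → ℂ} (hf : ContinuousOn f (ann R))
    (h1 : 1 / R < r) (h2 : r < R) : BddAbove ((fun z => ‖f z‖) '' {z : ℂ | ‖z‖ = r}) := by
  have hc : IsCompact {z : ℂ | ‖z‖ = r} := by
    have : {z : ℂ | ‖z‖ = r} = Metric.sphere 0 r := by ext; simp
    exact this ▸ isCompact_sphere _ _
  exact hc.bddAbove_image (hf.norm.mono (sphere_subset_ann h1 h2))

/-- A holomorphic function on the annulus that is not identically zero has positive maximum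
modulus on every concentric circle. -/
theorem sSup_norm_circle_pos {R : ℝ} (hR : 1 < R) {f : ℂ → ℂ}
    (hf : DifferentiableOn ℂ f (ann R)) (hnz : ∃ z ∈ ann R, f z ≠ 0) {r : ℝ}
    (h1 : 1 / R < r) (h2 : r < R) : 0 < sSup ((fun z => ‖f z‖) '' {z : ℂ | ‖z‖ = r}) := by
  have hR' : 0 < 1 / R := by positivity
  have hr : 0 < r := hR'.trans h1
  by_contra! hM
  obtain ⟨z, hz, hfz⟩ := hnz
  have hz0 : 0 < ‖z‖ := hR'.trans hz.1
  refine hfz ?_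
  have hg : DifferentiableOn ℂ (f ∘ exp)
      (HadamardThreeLines.verticalStrip (Real.log (1 / R)) (Real.log R)) :=
    hf.comp differentiable_exp.differentiableOn fun w hw => exp_mem_ann hR hw
  have hE := eqOn_zero_verticalStrip_of_eqOn_line hg (s := Real.log r)
    ⟨Real.log_lt_log hR' h1, Real.log_lt_log hr h2⟩ fun w hw => by
      have hmem : exp w ∈ {z : ℂ | ‖z‖ = r} := by
        simp [norm_exp, hw, Real.exp_log hr]
      have hle := (le_csSup (bddAbove_norm_image_circle hf.continuousOn h1 h2)
        (mem_image_of_mem _ hmem)).trans hM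
      simpa using hle
  have hz' : log z ∈ HadamardThreeLines.verticalStrip (Real.log (1 / R)) (Real.log R) := by
    simp only [HadamardThreeLines.verticalStrip, mem_preimage, log_re]
    exact ⟨Real.log_lt_log hR' hz.1, Real.log_lt_log hz0 hz.2⟩
  simpa [exp_log (norm_pos_iff.1 hz0)] using hE hz'

/-- Hadamard three-circle theorem on the annulus: for `f` holomorphic on `𝔸` and not
identically zero, with `M(r) = sup{|f(z)| : |z| = r}`, the function `log M(r)` is a convex
function of `log r`. -/
theorem stmt4 (R : ℝ) (hR : 1 < R) (f : ℂ → ℂ)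
    (hf : DifferentiableOn ℂ f (ann R))
    (hnz : ∃ z ∈ ann R, f z ≠ 0)
    (M : ℝ → ℝ)
    (hM : ∀ r : ℝ, M r = sSup ((fun z => ‖f z‖) '' {z : ℂ | ‖z‖ = r}))
    (r₁ r₂ r₃ : ℝ) (h1 : 1 / R < r₁) (h12 : r₁ < r₂) (h23 : r₂ < r₃) (h3 : r₃ < R) :
    Real.log (r₃ / r₁) * Real.log (M r₂) ≤
      Real.log (r₃ / r₂) * Real.log (M r₁) + Real.log (r₂ / r₁) * Real.log (M r₃) := by
  have hR' : 0 < 1 / R := by positivity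
  have hr₁ : 0 < r₁ := hR'.trans h1
  have hr₂ : 0 < r₂ := hr₁.trans h12
  have hr₃ : 0 < r₃ := hr₂.trans h23
  have hpos : ∀ r, 1 / R < r → r < R → 0 < M r := fun r ha hb =>
    hM r ▸ sSup_norm_circle_pos hR hf hnz ha hb
  have hM₁ := hpos r₁ h1 (by linarith)
  have hM₂ := hpos r₂ (by linarith) (by linarith)
  have hM₃ := hpos r₃ (by linarith) h3
  have hl₁₂ := Real.log_lt_log hr₁ h12
  have hl₂₃ := Real.log_lt_log hr₂ h23
  have hsub : {z : ℂ | r₁ ≤ ‖z‖ ∧ ‖z‖ ≤ r₃} ⊆ ann R := fun z hz =>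
    ⟨h1.trans_le hz.1, hz.2.trans_lt h3⟩
  have hexp : MapsTo exp (HadamardThreeLines.verticalClosedStrip (Real.log r₁) (Real.log r₃))
      {z : ℂ | r₁ ≤ ‖z‖ ∧ ‖z‖ ≤ r₃} := by
    rintro w ⟨ha, hb⟩
    simp only [mem_ofPred_eq, norm_exp]
    exact ⟨(Real.log_le_iff_le_exp hr₁).1 ha, (Real.le_log_iff_exp_le hr₃).1 hb⟩
  have hcl : closure (HadamardThreeLines.verticalStrip (Real.log r₁) (Real.log r₃)) =
      HadamardThreeLines.verticalClosedStrip (Real.log r₁) (Real.log r₃) := by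
    rw [HadamardThreeLines.verticalStrip, closure_preimage_re,
      closure_Ioo (hl₁₂.trans hl₂₃).ne, HadamardThreeLines.verticalClosedStrip]
  have hd : DiffContOnCl ℂ (f ∘ exp)
      (HadamardThreeLines.verticalStrip (Real.log r₁) (Real.log r₃)) := by
    apply DifferentiableOn.diffContOnCl
    rw [hcl]
    exact hf.comp differentiable_exp.differentiableOn (hexp.mono_right hsub)
  have hB : BddAbove ((norm ∘ (f ∘ exp)) ''
      HadamardThreeLines.verticalClosedStrip (Real.log r₁) (Real.log r₃)) := by
    have hc : IsCompact {z : ℂ | r₁ ≤ ‖z‖ ∧ ‖z‖ ≤ r₃} := by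
      refine (isCompact_closedBall (0 : ℂ) r₃).of_isClosed_subset ?_ fun z hz => by
        simpa using hz.2
      exact (isClosed_le continuous_const continuous_norm).inter
        (isClosed_le continuous_norm continuous_const)
    refine (hc.bddAbove_image (hf.continuousOn.norm.mono hsub)).mono ?_
    rintro _ ⟨w, hw, rfl⟩
    exact ⟨exp w, hexp hw, rfl⟩
  have hline : ∀ r, 1 / R < r → r < R → ∀ w ∈ re ⁻¹' {Real.log r}, ‖(f ∘ exp) w‖ ≤ M r := by
    intro r ha hb w hw
    rw [hM r]
    refine le_csSup (bddAbove_norm_image_circle hf.continuousOn ha hb) ⟨exp w, ?_, rfl⟩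
    have hw' : w.re = Real.log r := hw
    simp [norm_exp, hw', Real.exp_log (hR'.trans ha)]
  set θ := (Real.log r₂ - Real.log r₁) / (Real.log r₃ - Real.log r₁) with hθ
  have hle : M r₂ ≤ M r₁ ^ (1 - θ) * M r₃ ^ θ := by
    rw [hM r₂]
    refine csSup_le (Set.Nonempty.image _ ⟨(r₂ : ℂ), by simp [hr₂.le]⟩) ?_
    rintro _ ⟨z, rfl, rfl⟩
    have h := HadamardThreeLines.norm_le_interp_of_mem_verticalClosedStrip' (z := log z)
      (hl₁₂.trans hl₂₃) ⟨by rw [log_re]; exact hl₁₂.le, by rw [log_re]; exact hl₂₃.le⟩ hd hB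
      (hline r₁ h1 (by linarith)) (hline r₃ (by linarith) h3)
    simpa [exp_log (norm_pos_iff.1 hr₂), log_re, hθ] using h
  have hlog := Real.log_le_log hM₂ hle
  rw [Real.log_mul (by positivity) (by positivity), Real.log_rpow hM₁, Real.log_rpow hM₃] at hlog
  rw [Real.log_div hr₃.ne' hr₁.ne', Real.log_div hr₃.ne' hr₂.ne', Real.log_div hr₂.ne' hr₁.ne']
  have hD : 0 < Real.log r₃ - Real.log r₁ := by linarith
  have hθD : θ * (Real.log r₃ - Real.log r₁) = Real.log r₂ - Real.log r₁ :=
    div_mul_cancel₀ _ hD.ne'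
  calc (Real.log r₃ - Real.log r₁) * Real.log (M r₂)
      ≤ (Real.log r₃ - Real.log r₁) * ((1 - θ) * Real.log (M r₁) + θ * Real.log (M r₃)) := by
        gcongr
    _ = _ := by linear_combination (Real.log (M r₃) - Real.log (M r₁)) * hθD
end

section
/- Let f be holomorphic on 𝔸 and not identically zero, let 1/R < r₁ < r₂ < r₃ < R, and set M(r) = sup{|f(z)| : |z| = r}. Then equality log(r₃/r₁)·log M(r₂) = log(r₃/r₂)·log M(r₁) + log(r₂/r₁)·log M(r₃) holds if and only if there exist a constant c ∈ ℂ \ {0} and an integer n ∈ ℤ such that f(z) = c·zⁿ for all z ∈ 𝔸. -/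
open Complex Set

lemma exists_norm_eq_sSup_circle {f : ℂ → ℂ} {r : ℝ} (hr : 0 ≤ r)
    (hf : ContinuousOn f {z : ℂ | ‖z‖ = r}) :
    (∃ z : ℂ, ‖z‖ = r ∧ ‖f z‖ = sSup ((fun z => ‖f z‖) '' {z : ℂ | ‖z‖ = r})) ∧
      ∀ z : ℂ, ‖z‖ = r → ‖f z‖ ≤ sSup ((fun z => ‖f z‖) '' {z : ℂ | ‖z‖ = r}) := by
  have hs : {z : ℂ | ‖z‖ = r} = Metric.sphere 0 r := by ext z; simp
  have hc : IsCompact {z : ℂ | ‖z‖ = r} := hs ▸ isCompact_sphere 0 r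
  have hne : {z : ℂ | ‖z‖ = r}.Nonempty := ⟨(r : ℂ), by simp [abs_of_nonneg hr]⟩
  obtain ⟨z, hz, hzeq⟩ := hc.exists_sSup_image_eq hne hf.norm
  exact ⟨⟨z, hz, hzeq.symm⟩, fun w hw =>
    le_csSup (hc.bddAbove_image hf.norm) (mem_image_of_mem _ hw)⟩

lemma isOpen_re_preimage_Ioo (a b : ℝ) : IsOpen (re ⁻¹' Ioo a b) :=
  isOpen_Ioo.preimage continuous_re

lemma isPreconnected_re_preimage_Ioo (a b : ℝ) : IsPreconnected (re ⁻¹' Ioo a b) :=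
  ((convex_Ioo a b).is_linear_preimage reLm.isLinear).isPreconnected

lemma exp_mem_ann_iff {R : ℝ} (hR : 0 < R) (w : ℂ) :
    exp w ∈ ann R ↔ w ∈ re ⁻¹' Ioo (Real.log (1 / R)) (Real.log R) := by
  simp only [ann, mem_ofPred_eq, norm_exp, mem_preimage, mem_Ioo]
  rw [Real.log_lt_iff_lt_exp (by positivity), Real.lt_log_iff_exp_lt hR]

lemma differentiableOn_comp_exp {R : ℝ} (hR : 0 < R) {f : ℂ → ℂ}
    (hf : DifferentiableOn ℂ f (ann R)) :
    DifferentiableOn ℂ (fun w => f (exp w))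
      (re ⁻¹' Ioo (Real.log (1 / R)) (Real.log R)) :=
  hf.comp differentiable_exp.differentiableOn fun w hw => (exp_mem_ann_iff hR w).2 hw

lemma exists_ne_zero_on_circle {R : ℝ} (hR : 0 < R) {f : ℂ → ℂ}
    (hf : DifferentiableOn ℂ f (ann R)) (hnz : ∃ z ∈ ann R, f z ≠ 0)
    {r : ℝ} (h1 : 1 / R < r) (h2 : r < R) : ∃ z : ℂ, ‖z‖ = r ∧ f z ≠ 0 := by
  by_contra! h
  have hr : 0 < r := lt_trans (by positivity) h1
  have han := (differentiableOn_comp_exp hR hf).analyticOnNhd (isOpen_re_preimage_Ioo _ _)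
  have hmem : ((Real.log r : ℝ) : ℂ) ∈ re ⁻¹' Ioo (Real.log (1 / R)) (Real.log R) :=
    ⟨Real.log_lt_log (by positivity) h1, Real.log_lt_log hr h2⟩
  have hfreq : ∃ᶠ w in nhdsWithin ((Real.log r : ℝ) : ℂ) {((Real.log r : ℝ) : ℂ)}ᶜ,
      f (exp w) = 0 := by
    have ht : Filter.Tendsto (fun t : ℝ => ((Real.log r : ℝ) : ℂ) + t * I)
        (nhdsWithin 0 {0}ᶜ) (nhdsWithin ((Real.log r : ℝ) : ℂ) {((Real.log r : ℝ) : ℂ)}ᶜ) := by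
      apply tendsto_nhdsWithin_of_tendsto_nhds_of_eventually_within
      · have : Continuous fun t : ℝ => ((Real.log r : ℝ) : ℂ) + t * I := by fun_prop
        simpa using (this.tendsto 0).mono_left nhdsWithin_le_nhds
      · filter_upwards [self_mem_nhdsWithin] with t ht
        simpa using ht
    refine ht.frequently (Filter.Eventually.frequently (Filter.Eventually.of_forall fun t => ?_))
    exact h _ (by simp [norm_exp, Real.exp_log hr])
  have hz := han.eqOn_zero_of_preconnected_of_frequently_eq_zero
    (isPreconnected_re_preimage_Ioo _ _) hmem hfreq
  obtain ⟨z, hz1, hz2⟩ := hnz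
  have hz0 : z ≠ 0 := norm_pos_iff.1 (lt_trans (by positivity) hz1.1)
  have := hz ((exp_mem_ann_iff hR (log z)).1 (by rwa [exp_log hz0]))
  simp only [exp_log hz0] at this
  exact hz2 this

/-- If `|f z| |z| ^ (-a)` has an interior maximum on a subannulus, then `f` is a monomial. -/
lemma eq_monomial_of_interior_max {R : ℝ} (hR : 0 < R) {f : ℂ → ℂ}
    (hf : DifferentiableOn ℂ f (ann R)) (hnz : ∃ z ∈ ann R, f z ≠ 0)
    {r₁ r₃ a : ℝ} (h1 : 1 / R < r₁) (h3 : r₃ < R) {z₀ : ℂ} (hz1 : r₁ < ‖z₀‖) (hz3 : ‖z₀‖ < r₃)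
    (hmax : ∀ z : ℂ, r₁ ≤ ‖z‖ → ‖z‖ ≤ r₃ →
      ‖f z‖ * Real.exp (-a * Real.log ‖z‖) ≤ ‖f z₀‖ * Real.exp (-a * Real.log ‖z₀‖)) :
    ∃ c : ℂ, c ≠ 0 ∧ ∃ n : ℤ, ∀ z ∈ ann R, f z = c * z ^ n := by
  have hr1 : 0 < r₁ := lt_trans (by positivity) h1
  have hr3 : 0 < r₃ := hr1.trans (hz1.trans hz3)
  have hz₀ : z₀ ≠ 0 := norm_pos_iff.1 (hr1.trans hz1)
  set S := re ⁻¹' Ioo (Real.log (1 / R)) (Real.log R)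
  set T := re ⁻¹' Ioo (Real.log r₁) (Real.log r₃)
  have hTS : T ⊆ S := fun w hw =>
    ⟨(Real.log_lt_log (by positivity) h1).trans hw.1, hw.2.trans (Real.log_lt_log hr3 h3)⟩
  have hF := differentiableOn_comp_exp hR hf
  set g : ℂ → ℂ := fun w => f (exp w) * exp (-a * w) with hg
  have hgd : DifferentiableOn ℂ g S :=
    hF.mul (Differentiable.differentiableOn (by fun_prop))
  have hgn : ∀ w, ‖g w‖ = ‖f (exp w)‖ * Real.exp (-a * Real.log ‖exp w‖) := by
    intro w
    simp [hg, norm_exp]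
  have hw₀ : log z₀ ∈ T := by
    refine ⟨?_, ?_⟩ <;> rw [log_re]
    · exact Real.log_lt_log hr1 hz1
    · exact Real.log_lt_log (hr1.trans hz1) hz3
  have hm : IsMaxOn (norm ∘ g) T (log z₀) := by
    intro w hw
    simp only [mem_ofPred_eq, Function.comp_apply, hgn, exp_log hz₀]
    apply hmax <;> rw [norm_exp]
    · exact ((Real.log_lt_iff_lt_exp hr1).1 hw.1).le
    · exact ((Real.lt_log_iff_exp_lt hr3).1 hw.2).le
  have hT := eqOn_of_isPreconnected_of_isMaxOn_norm (isPreconnected_re_preimage_Ioo _ _)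
    (isOpen_re_preimage_Ioo _ _) (hgd.mono hTS) hw₀ hm
  have hS : EqOn g (fun _ => g (log z₀)) S :=
    (hgd.analyticOnNhd (isOpen_re_preimage_Ioo _ _)).eqOn_of_preconnected_of_eventuallyEq
      analyticOnNhd_const (isPreconnected_re_preimage_Ioo _ _) (hTS hw₀)
      (Filter.eventually_of_mem ((isOpen_re_preimage_Ioo _ _).mem_nhds hw₀) hT)
  have hfS : ∀ w ∈ S, f (exp w) = g (log z₀) * exp (a * w) := by
    intro w hw
    rw [← show g w = g (log z₀) from hS hw]
    simp only [hg]
    rw [mul_assoc, ← exp_add]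
    simp
  have hlog : ∀ z ∈ ann R, z ≠ 0 ∧ log z ∈ S := by
    intro z hz
    have hz0 : z ≠ 0 := norm_pos_iff.1 (lt_trans (by positivity) hz.1)
    exact ⟨hz0, (exp_mem_ann_iff hR (log z)).1 (by rwa [exp_log hz0])⟩
  have hc : g (log z₀) ≠ 0 := by
    intro h0
    obtain ⟨z, hz, hfz⟩ := hnz
    obtain ⟨hz0, hzS⟩ := hlog z hz
    have := hfS _ hzS
    rw [exp_log hz0, h0, zero_mul] at this
    exact hfz this
  have hper : exp (a * (2 * Real.pi * I)) = 1 := by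
    have e1 := hfS (log z₀) (hTS hw₀)
    have e2 := hfS (log z₀ + 2 * Real.pi * I) (by simpa [S] using hTS hw₀)
    rw [exp_periodic, e1, mul_add, exp_add, ← mul_assoc] at e2
    exact (mul_left_cancel₀ (mul_ne_zero hc (exp_ne_zero _)) (by rw [mul_one]; exact e2)).symm
  obtain ⟨n, hn⟩ := exp_eq_one_iff.1 hper
  have han : (a : ℂ) = n := mul_right_cancel₀ two_pi_I_ne_zero hn
  refine ⟨g (log z₀), hc, n, fun z hz => ?_⟩
  obtain ⟨hz0, hzS⟩ := hlog z hz
  have := hfS _ hzS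
  rwa [han, exp_int_mul, exp_log hz0] at this

/-- Equality case of the Hadamard three-circle theorem on the annulus: equality holds
iff `f(z) = c·zⁿ` for some `c ≠ 0` and `n ∈ ℤ`. -/
theorem stmt5 (R : ℝ) (hR : 1 < R) (f : ℂ → ℂ)
    (hf : DifferentiableOn ℂ f (ann R))
    (hnz : ∃ z ∈ ann R, f z ≠ 0)
    (M : ℝ → ℝ)
    (hM : ∀ r : ℝ, M r = sSup ((fun z => ‖f z‖) '' {z : ℂ | ‖z‖ = r}))
    (r₁ r₂ r₃ : ℝ) (h1 : 1 / R < r₁) (h12 : r₁ < r₂) (h23 : r₂ < r₃) (h3 : r₃ < R) :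
    Real.log (r₃ / r₁) * Real.log (M r₂) =
        Real.log (r₃ / r₂) * Real.log (M r₁) + Real.log (r₂ / r₁) * Real.log (M r₃) ↔
      ∃ c : ℂ, c ≠ 0 ∧ ∃ n : ℤ, ∀ z ∈ ann R, f z = c * z ^ n := by
  have hR0 : 0 < R := by linarith
  have hr1 : 0 < r₁ := lt_trans (by positivity) h1
  have hr2 := hr1.trans h12
  have hr3 := hr2.trans h23
  rw [Real.log_div hr3.ne' hr1.ne', Real.log_div hr3.ne' hr2.ne', Real.log_div hr2.ne' hr1.ne']
  have hcirc : ∀ r, 1 / R < r → r < R →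
      (∃ z : ℂ, ‖z‖ = r ∧ ‖f z‖ = M r) ∧ ∀ z : ℂ, ‖z‖ = r → ‖f z‖ ≤ M r := by
    intro r hr hr'
    rw [hM]
    refine exists_norm_eq_sSup_circle (le_trans (by positivity) hr.le) (hf.continuousOn.mono ?_)
    rintro z rfl
    exact ⟨hr, hr'⟩
  have h1R : r₁ < R := by linarith
  have h2R : r₂ < R := by linarith
  have hR2 : 1 / R < r₂ := by linarith
  have hR3 : 1 / R < r₃ := by linarith
  constructor
  · intro heq
    have hpos : ∀ r, 1 / R < r → r < R → 0 < M r := by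
      intro r hr hr'
      obtain ⟨z, hz, hfz⟩ := exists_ne_zero_on_circle hR0 hf hnz hr hr'
      exact (norm_pos_iff.2 hfz).trans_le ((hcirc r hr hr').2 z hz)
    have hl : Real.log r₃ - Real.log r₁ ≠ 0 :=
      sub_ne_zero.2 (Real.log_lt_log hr1 (h12.trans h23)).ne'
    obtain ⟨a, ha⟩ : ∃ a, a * (Real.log r₃ - Real.log r₁) = Real.log (M r₃) - Real.log (M r₁) :=
      ⟨_, div_mul_cancel₀ _ hl⟩
    have k3 : Real.log (M r₃) + -a * Real.log r₃ = Real.log (M r₁) + -a * Real.log r₁ := by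
      linarith
    have k2 : Real.log (M r₂) + -a * Real.log r₂ = Real.log (M r₁) + -a * Real.log r₁ := by
      apply mul_left_cancel₀ hl
      linear_combination heq - (Real.log r₂ - Real.log r₁) * ha
    have hexp : ∀ r, 1 / R < r → r < R →
        M r * Real.exp (-a * Real.log r) = Real.exp (Real.log (M r) + -a * Real.log r) := by
      intro r hr hr'
      rw [Real.exp_add, Real.exp_log (hpos r hr hr')]
    have hcpt : IsCompact {z : ℂ | r₁ ≤ ‖z‖ ∧ ‖z‖ ≤ r₃} := by
      refine (isCompact_closedBall (0 : ℂ) r₃).of_isClosed_subset ?_ fun z hz => by simpa using hz.2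
      exact (isClosed_le continuous_const continuous_norm).inter
        (isClosed_le continuous_norm continuous_const)
    obtain ⟨z₂, hz₂, hfz₂⟩ := (hcirc r₂ hR2 h2R).1
    have hcont : ContinuousOn (fun z => ‖f z‖ * Real.exp (-a * Real.log ‖z‖))
        {z : ℂ | r₁ ≤ ‖z‖ ∧ ‖z‖ ≤ r₃} := by
      refine ContinuousOn.mul ?_ ?_
      · exact (hf.continuousOn.mono fun z hz => ⟨h1.trans_le hz.1, hz.2.trans_lt h3⟩).norm
      · refine Real.continuous_exp.comp_continuousOn (continuousOn_const.mul ?_)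
        exact continuous_norm.continuousOn.log fun z hz => (hr1.trans_le hz.1).ne'
    obtain ⟨z₀, hz₀, hmax⟩ := hcpt.exists_isMaxOn
      ⟨z₂, by rw [hz₂]; exact h12.le, by rw [hz₂]; exact h23.le⟩ hcont
    have hv2 : ‖f z₂‖ * Real.exp (-a * Real.log ‖z₂‖) =
        Real.exp (Real.log (M r₁) + -a * Real.log r₁) := by
      rw [hfz₂, hz₂, hexp r₂ hR2 h2R, k2]
    by_cases hint : r₁ < ‖z₀‖ ∧ ‖z₀‖ < r₃
    · exact eq_monomial_of_interior_max hR0 hf hnz h1 h3 hint.1 hint.2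
        fun z hz hz' => hmax ⟨hz, hz'⟩
    · have hle : ‖f z₀‖ * Real.exp (-a * Real.log ‖z₀‖) ≤
          Real.exp (Real.log (M r₁) + -a * Real.log r₁) := by
        rcases hz₀.1.eq_or_lt with h | h
        · rw [← hexp r₁ h1 h1R, ← h]
          gcongr
          exact (hcirc r₁ h1 h1R).2 _ h.symm
        · have h' : ‖z₀‖ = r₃ := le_antisymm hz₀.2 (not_lt.1 fun h' => hint ⟨h, h'⟩)
          rw [← k3, ← hexp r₃ hR3 h3, h']
          gcongr
          exact (hcirc r₃ hR3 h3).2 _ h'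
      exact eq_monomial_of_interior_max hR0 hf hnz h1 h3 (hz₂ ▸ h12) (hz₂ ▸ h23)
        fun z hz hz' => (hmax ⟨hz, hz'⟩).trans (hle.trans hv2.ge)
  · rintro ⟨c, hc, n, hfc⟩
    have hlogM : ∀ r, 1 / R < r → r < R → Real.log (M r) = Real.log ‖c‖ + n * Real.log r := by
      intro r hr hr'
      obtain ⟨z, rfl, hz⟩ := (hcirc r hr hr').1
      have hz0 : 0 < ‖z‖ := lt_trans (by positivity) hr
      rw [← hz, hfc z ⟨hr, hr'⟩, norm_mul, norm_zpow,
        Real.log_mul (norm_ne_zero_iff.2 hc) (zpow_ne_zero _ hz0.ne'), Real.log_zpow]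
    rw [hlogM r₁ h1 h1R, hlogM r₂ hR2 h2R, hlogM r₃ hR3 h3]
    ring
end

section
/- Let f be holomorphic on 𝔸 and let 1/R < r₁ < r₂ < r₃ < R. Assume that for each j = 1, 2, 3, f maps the circle {|z| = rⱼ} into the circle {|w| = rⱼ} (i.e. |f(z)| = rⱼ whenever |z| = rⱼ). Then there exists a constant c with |c| = 1 such that f(z) = c·z for all z ∈ 𝔸. -/
open Complex Set

lemma isOpen_ann (R : ℝ) : IsOpen (ann R) :=
  (isOpen_lt continuous_const continuous_norm).inter (isOpen_lt continuous_norm continuous_const)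

lemma isPreconnected_ann {R : ℝ} (hR : 0 < R) : IsPreconnected (ann R) := by
  have himage : ann R =
      (fun p : ℝ × ℝ => (p.1 : ℂ) * Complex.exp (p.2 * I)) '' (Ioo (1 / R) R ×ˢ univ) := by
    ext z
    constructor
    · rintro ⟨hz₁, hz₂⟩
      exact ⟨(‖z‖, z.arg), ⟨⟨hz₁, hz₂⟩, mem_univ _⟩, Complex.norm_mul_exp_arg_mul_I z⟩
    · rintro ⟨⟨r, t⟩, ⟨⟨hr₁, hr₂⟩, -⟩, rfl⟩
      have hr : 0 < r := (one_div_pos.mpr hR).trans hr₁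
      have hnorm : ‖(r : ℂ) * Complex.exp (t * I)‖ = r := by
        rw [norm_mul, Complex.norm_exp_ofReal_mul_I, mul_one, Complex.norm_real,
          Real.norm_of_nonneg hr.le]
      simpa only [ann, mem_ofPred_eq, hnorm] using And.intro hr₁ hr₂
  rw [himage]
  exact (isPreconnected_Ioo.prod isPreconnected_univ).image _ (by fun_prop)

/-- Maximum modulus principle on a round annulus. -/
lemma norm_le_one_of_norm_eq_one_on_circles {g : ℂ → ℂ} {a b : ℝ}
    (hg : DifferentiableOn ℂ g {z | a ≤ ‖z‖ ∧ ‖z‖ ≤ b})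
    (ha : ∀ z : ℂ, ‖z‖ = a → ‖g z‖ = 1) (hb : ∀ z : ℂ, ‖z‖ = b → ‖g z‖ = 1)
    {z : ℂ} (hz : a < ‖z‖ ∧ ‖z‖ < b) : ‖g z‖ ≤ 1 := by
  set U : Set ℂ := {z | a < ‖z‖ ∧ ‖z‖ < b} with hU
  have hUopen : IsOpen U :=
    (isOpen_lt continuous_const continuous_norm).inter
      (isOpen_lt continuous_norm continuous_const)
  have hcl : closure U ⊆ {z | a ≤ ‖z‖ ∧ ‖z‖ ≤ b} :=
    closure_minimal (fun w hw => ⟨hw.1.le, hw.2.le⟩)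
      ((isClosed_le continuous_const continuous_norm).inter
        (isClosed_le continuous_norm continuous_const))
  have hbdd : Bornology.IsBounded U :=
    Metric.isBounded_ball.subset fun w hw => mem_ball_zero_iff.mpr hw.2
  refine Complex.norm_le_of_forall_mem_frontier_norm_le hbdd (hg.mono hcl).diffContOnCl ?_
    (subset_closure hz)
  intro w hw
  rw [hUopen.frontier_eq] at hw
  obtain ⟨h₁, h₂⟩ := hcl hw.1
  rcases h₁.eq_or_lt with h | h
  · exact (ha w h.symm).le
  · rcases h₂.eq_or_lt with h' | h'
    · exact (hb w h').le
    · exact absurd ⟨h, h'⟩ hw.2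

/-- A holomorphic map on the annulus preserving three circles `|z| = rⱼ` (j = 1, 2, 3)
is a rotation `z ↦ c·z` with `|c| = 1`. -/
theorem stmt6 (R : ℝ) (hR : 1 < R) (f : ℂ → ℂ)
    (hf : DifferentiableOn ℂ f (ann R))
    (r₁ r₂ r₃ : ℝ) (h1 : 1 / R < r₁) (h12 : r₁ < r₂) (h23 : r₂ < r₃) (h3 : r₃ < R)
    (hc1 : ∀ z : ℂ, ‖z‖ = r₁ → ‖f z‖ = r₁)
    (hc2 : ∀ z : ℂ, ‖z‖ = r₂ → ‖f z‖ = r₂)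
    (hc3 : ∀ z : ℂ, ‖z‖ = r₃ → ‖f z‖ = r₃) :
    ∃ c : ℂ, ‖c‖ = 1 ∧ ∀ z ∈ ann R, f z = c * z := by
  have hR0 : 0 < R := one_pos.trans hR
  have hr₁ : 0 < r₁ := (one_div_pos.mpr hR0).trans h1
  have hr₂ : 0 < r₂ := hr₁.trans h12
  have hr₃ : 0 < r₃ := hr₂.trans h23
  have hne : ∀ z ∈ ann R, z ≠ 0 := fun z hz =>
    norm_pos_iff.mp ((one_div_pos.mpr hR0).trans hz.1)
  set g : ℂ → ℂ := fun z => f z / z with hgdef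
  have hg : DifferentiableOn ℂ g (ann R) := hf.div differentiableOn_id hne
  have hcircle : ∀ r : ℝ, 0 < r → (∀ z : ℂ, ‖z‖ = r → ‖f z‖ = r) →
      ∀ z : ℂ, ‖z‖ = r → ‖g z‖ = 1 := fun r hr h z hz => by
    rw [hgdef, norm_div, h z hz, hz, div_self hr.ne']
  have hp : ‖(r₂ : ℂ)‖ = r₂ := by rw [Complex.norm_real, Real.norm_of_nonneg hr₂.le]
  have hpA : (r₂ : ℂ) ∈ ann R :=
    ⟨by rw [hp]; exact h1.trans h12, by rw [hp]; exact h23.trans h3⟩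
  have hgp : ‖g r₂‖ = 1 := hcircle r₂ hr₂ hc2 _ hp
  have hmax : IsLocalMax (norm ∘ g) (r₂ : ℂ) := by
    have hnear : ∀ᶠ z : ℂ in nhds (r₂ : ℂ), r₁ < ‖z‖ ∧ ‖z‖ < r₃ :=
      (continuous_norm.continuousAt.eventually_const_lt (h12.trans_eq hp.symm)).and
        (continuous_norm.continuousAt.eventually_lt_const (hp.trans_lt h23))
    filter_upwards [hnear] with z hz
    rw [Function.comp_apply, Function.comp_apply, hgp]
    exact norm_le_one_of_norm_eq_one_on_circles
      (hg.mono fun w hw => ⟨h1.trans_le hw.1, hw.2.trans_lt h3⟩)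
      (hcircle r₁ hr₁ hc1) (hcircle r₃ hr₃ hc3) hz
  have hloc : ∀ᶠ z in nhds (r₂ : ℂ), g z = g r₂ :=
    Complex.eventually_eq_of_isLocalMax_norm
      (hg.eventually_differentiableAt ((isOpen_ann R).mem_nhds hpA)) hmax
  have hconst : EqOn g (fun _ => g r₂) (ann R) :=
    (hg.analyticOnNhd (isOpen_ann R)).eqOn_of_preconnected_of_eventuallyEq
      analyticOnNhd_const (isPreconnected_ann hR0) hpA hloc
  exact ⟨g r₂, hgp, fun z hz => (div_eq_iff (hne z hz)).mp (hconst hz)⟩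
end

section
/- Let f be holomorphic on 𝔸, let r ∈ (1/R, R) and ρ > 0, and assume sup{|f(z)| : |z| = r} = ρ. Then the set Ξ = {ξ ∈ ℂ : |ξ| = r and |f(ξ)| = ρ} is either equal to the full circle {z : |z| = r} or is a finite set. -/
open Complex Set

/-- A real analytic function on the line either vanishes identically or has finitely many zeros
in each compact set. -/
theorem eq_zero_or_finite_zeros_of_analyticOnNhd_real {g : ℝ → ℝ} (hg : AnalyticOnNhd ℝ g univ)
    {K : Set ℝ} (hK : IsCompact K) : (∀ t, g t = 0) ∨ {t ∈ K | g t = 0}.Finite := by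
  refine or_iff_not_imp_right.2 fun h => ?_
  obtain ⟨x, -, hx⟩ := Set.Infinite.exists_accPt_of_subset_isCompact h hK (sep_subset K _)
  have hfreq : ∃ᶠ t in nhdsWithin x {x}ᶜ, g t = 0 :=
    (accPt_iff_frequently_nhdsNE.1 hx).mono fun t ht => ht.2
  intro t
  exact hg.eqOn_zero_of_preconnected_of_frequently_eq_zero isPreconnected_univ (mem_univ x) hfreq
    (mem_univ t)

/-- If `f` is analytic along a circle, then `‖f‖ ^ 2` is a real analytic function of the angle. -/
theorem analyticOnNhd_norm_sq_comp_circleMap {f : ℂ → ℂ} {c : ℂ} {r : ℝ}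
    (hf : ∀ t, AnalyticAt ℂ f (circleMap c r t)) :
    AnalyticOnNhd ℝ (fun t => ‖f (circleMap c r t)‖ ^ 2) univ := by
  intro t _
  have h : AnalyticAt ℝ (fun s => f (circleMap c r s)) t :=
    (hf t).restrictScalars.comp (analyticOnNhd_circleMap c r t (mem_univ t))
  have hre := (reCLM.analyticAt _).comp h
  have him := (imCLM.analyticAt _).comp h
  refine ((hre.mul hre).add (him.mul him)).congr (Filter.Eventually.of_forall fun s => ?_)
  simp [← normSq_eq_norm_sq, normSq_apply]

/-- If `f` is holomorphic on the annulus and `sup{|f(z)| : |z| = r} = ρ`, then the set of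
points of the circle `|z| = r` where `|f| = ρ` is either the whole circle or finite. -/
theorem stmt7 (R : ℝ) (hR : 1 < R) (f : ℂ → ℂ)
    (hf : DifferentiableOn ℂ f (ann R))
    (r ρ : ℝ) (hr : 1 / R < r) (hr' : r < R) (hρ : 0 < ρ)
    (hsup : sSup ((fun z => ‖f z‖) '' {z : ℂ | ‖z‖ = r}) = ρ) :
    {ξ : ℂ | ‖ξ‖ = r ∧ ‖f ξ‖ = ρ} = {z : ℂ | ‖z‖ = r} ∨
      Set.Finite {ξ : ℂ | ‖ξ‖ = r ∧ ‖f ξ‖ = ρ} := by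
  have hr0 : 0 < r := lt_trans (by positivity) hr
  have hnorm : ∀ t, ‖circleMap 0 r t‖ = r := fun t => by simp [abs_of_pos hr0]
  have hopen : IsOpen (ann R) :=
    (isOpen_lt continuous_const continuous_norm).inter (isOpen_lt continuous_norm continuous_const)
  have hfa : ∀ t, AnalyticAt ℂ f (circleMap 0 r t) := fun t =>
    hf.analyticAt (hopen.mem_nhds ⟨by rwa [hnorm], by rwa [hnorm]⟩)
  have hang : ∀ z : ℂ, ‖z‖ = r → ∃ t ∈ Icc 0 (2 * Real.pi), circleMap 0 r t = z := by
    intro z hz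
    have hmem : z ∈ circleMap 0 r '' Ioc 0 (2 * Real.pi) := by
      rw [image_circleMap_Ioc]
      simp [abs_of_pos hr0, hz]
    obtain ⟨t, ht, rfl⟩ := hmem
    exact ⟨t, Ioc_subset_Icc_self ht, rfl⟩
  have hzero : ∀ t, ‖f (circleMap 0 r t)‖ ^ 2 - ρ ^ 2 = 0 ↔ ‖f (circleMap 0 r t)‖ = ρ := fun t => by
    rw [sub_eq_zero, sq_eq_sq₀ (norm_nonneg _) hρ.le]
  have hg : AnalyticOnNhd ℝ (fun t => ‖f (circleMap 0 r t)‖ ^ 2 - ρ ^ 2) univ :=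
    (analyticOnNhd_norm_sq_comp_circleMap hfa).sub analyticOnNhd_const
  rcases eq_zero_or_finite_zeros_of_analyticOnNhd_real hg
    (isCompact_Icc (a := 0) (b := 2 * Real.pi)) with h | h
  · left
    ext z
    refine ⟨fun hz => hz.1, fun hz => ⟨hz, ?_⟩⟩
    obtain ⟨t, -, rfl⟩ := hang z hz
    exact (hzero t).1 (h t)
  · right
    refine (h.image (circleMap 0 r)).subset ?_
    rintro z ⟨hz, hfz⟩
    obtain ⟨t, ht, rfl⟩ := hang z hz
    exact ⟨t, ⟨ht, (hzero t).2 hfz⟩, rfl⟩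
end

section
/- Let s > 1 and suppose g is holomorphic and nonvanishing on the annulus 𝔸ₛ = {z ∈ ℂ : 1/s < |z| < s}. Then there exist an integer n ∈ ℤ and a function h holomorphic on 𝔸ₛ such that g(z) = zⁿ · exp(h(z)) for all z ∈ 𝔸ₛ. -/
open Complex Set

/-- A continuous logarithm of a differentiable function is differentiable. -/
theorem differentiableAt_of_differentiableAt_cexp {f : ℂ → ℂ} {a : ℂ} (hc : ContinuousAt f a)
    (hd : DifferentiableAt ℂ (fun w => exp (f w)) a) : DifferentiableAt ℂ f a := by
  have hd' : DifferentiableAt ℂ (fun w => log (exp (f w) / exp (f a)) + f a) a := by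
    refine ((hd.div_const _).clog ?_).add_const _
    rw [div_self (exp_ne_zero _)]
    exact one_mem_slitPlane
  refine hd'.congr_of_eventuallyEq ?_
  have him : ContinuousAt (fun w => (f w - f a).im) a :=
    continuous_im.continuousAt.comp (hc.sub continuousAt_const)
  have hmem : Ioo (-Real.pi) Real.pi ∈ nhds ((f a - f a).im) := by
    rw [sub_self, zero_im]
    exact Ioo_mem_nhds (neg_lt_zero.2 Real.pi_pos) Real.pi_pos
  filter_upwards [him hmem] with w hw
  rw [← exp_sub, log_exp hw.1 hw.2.le, sub_add_cancel]

/-- A `2πi`-periodic function that is differentiable on the preimage of `U` under `exp` descends to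
a differentiable function on `U`. -/
theorem differentiableOn_comp_log_of_periodic {F : ℂ → ℂ} {U : Set ℂ} (hU : IsOpen U)
    (h_zero : 0 ∉ U) (hper : Function.Periodic F (2 * Real.pi * I))
    (hF : DifferentiableOn ℂ F (exp ⁻¹' U)) : DifferentiableOn ℂ (fun z => F (log z)) U := by
  intro a ha
  have ha_ne : a ≠ 0 := ne_of_mem_of_not_mem ha h_zero
  have hbranch : DifferentiableAt ℂ (fun z => log (z / a) + log a) a := by
    refine ((differentiableAt_id.div_const _).clog ?_).add_const _
    simp [div_self ha_ne]
  have hFa : DifferentiableAt ℂ F (log (a / a) + log a) := by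
    refine hF.differentiableAt ((hU.preimage continuous_exp).mem_nhds ?_)
    simpa [div_self ha_ne, exp_log ha_ne] using ha
  refine ((hFa.comp a hbranch).congr_of_eventuallyEq ?_).differentiableWithinAt
  filter_upwards [hU.mem_nhds ha] with z hz
  have hz_ne : z ≠ 0 := ne_of_mem_of_not_mem hz h_zero
  have hexp : exp (log (z / a) + log a) = exp (log z) := by
    rw [exp_add, exp_log (div_ne_zero hz_ne ha_ne), exp_log ha_ne, exp_log hz_ne,
      div_mul_cancel₀ _ ha_ne]
  obtain ⟨k, hk⟩ := exp_eq_exp_iff_exists_int.1 hexp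
  simp only [Function.comp_apply, hk, hper.int_mul k _]

/-- If `U` is an open set whose preimage under `exp` is simply connected, then every nonvanishing
holomorphic function on `U` is a power of `z` times the exponential of a holomorphic function. -/
theorem exists_eq_zpow_mul_exp_of_isSimplyConnected_preimage_exp {U : Set ℂ} (hU : IsOpen U)
    (h_zero : 0 ∉ U) (hS : IsSimplyConnected (exp ⁻¹' U)) {g : ℂ → ℂ}
    (hg : DifferentiableOn ℂ g U) (hnz : ∀ z ∈ U, g z ≠ 0) :
    ∃ n : ℤ, ∃ h : ℂ → ℂ, DifferentiableOn ℂ h U ∧ ∀ z ∈ U, g z = z ^ n * exp (h z) := by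
  set S : Set ℂ := exp ⁻¹' U with hSdef
  have hSo : IsOpen S := hU.preimage continuous_exp
  have hG : DifferentiableOn ℂ (fun w => g (exp w)) S :=
    hg.comp differentiable_exp.differentiableOn (mapsTo_preimage _ _)
  obtain ⟨L, hLc, hL⟩ := exists_continuousOn_eqOn_exp_comp hS hSo hG.continuousOn
    (by rintro ⟨w, hw, hw'⟩; exact hnz _ hw hw')
  have hLd : DifferentiableOn ℂ L S := fun w hw =>
    (differentiableAt_of_differentiableAt_cexp (hLc.continuousAt (hSo.mem_nhds hw))
      ((hG.differentiableAt (hSo.mem_nhds hw)).congr_of_eventuallyEq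
        (hL.eventuallyEq_of_mem (hSo.mem_nhds hw)))).differentiableWithinAt
  have hshift : ∀ w, w + 2 * Real.pi * I ∈ S ↔ w ∈ S := fun w => by
    simp only [hSdef, mem_preimage, exp_periodic w]
  have hint : ∀ w ∈ S, ∃ k : ℤ, L (w + 2 * Real.pi * I) = L w + k * (2 * Real.pi * I) := by
    intro w hw
    rw [← exp_eq_exp_iff_exists_int]
    have h₁ := hL ((hshift w).2 hw)
    have h₂ := hL hw
    simp only [Function.comp_apply, exp_periodic w] at h₁ h₂
    rw [h₁, h₂]
  have hconst : ∃ n : ℤ, ∀ w ∈ S, L (w + 2 * Real.pi * I) = L w + n * (2 * Real.pi * I) := by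
    choose! k hk using hint
    obtain ⟨w₀, hw₀⟩ := hS.nonempty
    refine ⟨k w₀, fun w hw => ?_⟩
    have hdiscrete : IsDiscrete (range ((↑) : ℤ → ℂ)) :=
      Complex.isClosedEmbedding_intCast.isInducing.isDiscrete_range
    have hkc : ContinuousOn
        (fun w => (L (w + 2 * Real.pi * I) - L w) / (2 * Real.pi * I)) S :=
      ((hLc.comp (by fun_prop) fun w hw => (hshift w).2 hw).sub hLc).div_const _
    have hkval : ∀ w ∈ S, (L (w + 2 * Real.pi * I) - L w) / (2 * Real.pi * I) = k w := by
      intro w hw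
      rw [hk w hw, add_sub_cancel_left, mul_div_cancel_right₀ _ two_pi_I_ne_zero]
    have heq := hS.isPathConnected.isConnected.isPreconnected.constant_of_mapsTo hdiscrete hkc
      (fun w hw => ⟨k w, (hkval w hw).symm⟩) hw hw₀
    simp only [hkval w hw, hkval w₀ hw₀] at heq
    rw [hk w hw, heq]
  obtain ⟨n, hn⟩ := hconst
  have hper : Function.Periodic (S.indicator fun w => L w - n * w) (2 * Real.pi * I) := by
    intro w
    by_cases hw : w ∈ S
    · rw [indicator_of_mem hw, indicator_of_mem ((hshift w).2 hw), hn w hw]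
      ring
    · rw [indicator_of_notMem hw, indicator_of_notMem (mt (hshift w).1 hw)]
  have hdiff : DifferentiableOn ℂ (S.indicator fun w => L w - n * w) S :=
    (hLd.sub (by fun_prop : DifferentiableOn ℂ (fun w : ℂ => n * w) S)).congr
      fun w hw => indicator_of_mem hw _
  refine ⟨n, _, differentiableOn_comp_log_of_periodic hU h_zero hper hdiff, fun z hz => ?_⟩
  have hz_ne : z ≠ 0 := ne_of_mem_of_not_mem hz h_zero
  have hlog : log z ∈ S := by rwa [hSdef, mem_preimage, exp_log hz_ne]
  have hLz := hL hlog
  simp only [Function.comp_apply, exp_log hz_ne] at hLz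
  rw [indicator_of_mem hlog, exp_sub, hLz, exp_int_mul, exp_log hz_ne,
    mul_div_cancel₀ _ (zpow_ne_zero n hz_ne)]

/-- The preimage under `exp` of an open annulus is a vertical strip, hence convex. -/
theorem convex_preimage_exp_annulus {r R : ℝ} (hr : 0 < r) (hR : 0 < R) :
    Convex ℝ (exp ⁻¹' {z : ℂ | r < ‖z‖ ∧ ‖z‖ < R}) := by
  have hstrip : exp ⁻¹' {z : ℂ | r < ‖z‖ ∧ ‖z‖ < R} =
      {w : ℂ | Real.log r < w.re} ∩ {w : ℂ | w.re < Real.log R} := by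
    ext w
    simp [norm_exp, Real.log_lt_iff_lt_exp hr, Real.lt_log_iff_exp_lt hR]
  rw [hstrip]
  exact (convex_halfSpace_re_gt _).inter (convex_halfSpace_re_lt _)

/-- A holomorphic nonvanishing function on the annulus `𝔸ₛ = {1/s < |z| < s}` has a
holomorphic logarithm after extracting a suitable power of `z`:
`g(z) = zⁿ · exp(h(z))` on `𝔸ₛ`. -/
theorem stmt10 (s : ℝ) (hs : 1 < s) (g : ℂ → ℂ)
    (hg : DifferentiableOn ℂ g {z : ℂ | 1 / s < ‖z‖ ∧ ‖z‖ < s})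
    (hnz : ∀ z : ℂ, 1 / s < ‖z‖ → ‖z‖ < s → g z ≠ 0) :
    ∃ n : ℤ, ∃ h : ℂ → ℂ,
      DifferentiableOn ℂ h {z : ℂ | 1 / s < ‖z‖ ∧ ‖z‖ < s} ∧
      ∀ z : ℂ, 1 / s < ‖z‖ → ‖z‖ < s →
        g z = z ^ n * Complex.exp (h z) := by
  have hs_pos : 0 < s := one_pos.trans hs
  have hr : 0 < 1 / s := one_div_pos.2 hs_pos
  have hU : IsOpen {z : ℂ | 1 / s < ‖z‖ ∧ ‖z‖ < s} :=
    (isOpen_lt continuous_const continuous_norm).inter (isOpen_lt continuous_norm continuous_const)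
  have hS : IsSimplyConnected (exp ⁻¹' {z : ℂ | 1 / s < ‖z‖ ∧ ‖z‖ < s}) := by
    have hne : (exp ⁻¹' {z : ℂ | 1 / s < ‖z‖ ∧ ‖z‖ < s}).Nonempty :=
      ⟨0, by simpa using ⟨inv_lt_one_of_one_lt₀ hs, hs⟩⟩
    have := (convex_preimage_exp_annulus hr hs_pos).contractibleSpace hne
    exact SimplyConnectedSpace.ofContractible _
  obtain ⟨n, h, hh, heq⟩ := exists_eq_zpow_mul_exp_of_isSimplyConnected_preimage_exp hU
    (fun h => by simpa using hr.trans h.1) hS hg fun z hz => hnz z hz.1 hz.2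
  exact ⟨n, h, hh, fun z h₁ h₂ => heq z ⟨h₁, h₂⟩⟩
end

section
/- Define p₁ = 1 and p_{n+1} = 2^{(n^{p_n})} for n ≥ 1, set θ = Σ_{n=1}^∞ 1/pₙ and β = exp(iπθ). Then there is no holomorphic function f on 𝔸 such that f(β·z) + f(z) = z/(R − z) for all z ∈ 𝔸. Consequently, the operator T defined by (Tf)(z) = f(β·z) on holomorphic functions on 𝔸 has −1 in its spectrum, although −1 is not an eigenvalue of T (since θ is irrational, βᵏ ≠ −1 for all k ∈ ℤ). -/
open Complex Set

lemma two_mul_le_succ {p : ℕ → ℕ} (hp1 : p 1 = 1)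
    (hrec : ∀ n : ℕ, 1 ≤ n → p (n + 1) = 2 ^ (n ^ p n)) (n : ℕ) :
    2 * p (n + 1) ≤ p (n + 2) := by
  rw [hrec (n + 1) (by omega)]
  rcases n with _ | n
  · simp [hp1]
  · have h1 : p (n + 2) < 2 ^ p (n + 2) := Nat.lt_two_pow_self
    have h2 : 2 ^ p (n + 2) ≤ (n + 2) ^ p (n + 2) := Nat.pow_le_pow_left (by omega) _
    calc 2 * p (n + 2) ≤ 2 * 2 ^ p (n + 2) := by omega
      _ = 2 ^ (p (n + 2) + 1) := by ring
      _ ≤ _ := Nat.pow_le_pow_right (by norm_num) (by show _ ≤ (n + 2) ^ p (n + 2); omega)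

lemma exists_eq_two_pow {p : ℕ → ℕ} (hp1 : p 1 = 1)
    (hrec : ∀ n : ℕ, 1 ≤ n → p (n + 1) = 2 ^ (n ^ p n)) (n : ℕ) :
    ∃ e, p (n + 1) = 2 ^ e := by
  rcases n with _ | n
  · exact ⟨0, by simpa using hp1⟩
  · exact ⟨_, hrec (n + 1) (by omega)⟩

lemma two_mul_dvd_succ {p : ℕ → ℕ} (hp1 : p 1 = 1)
    (hrec : ∀ n : ℕ, 1 ≤ n → p (n + 1) = 2 ^ (n ^ p n)) (n : ℕ) :
    2 * p (n + 1) ∣ p (n + 2) := by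
  have h := two_mul_le_succ hp1 hrec n
  obtain ⟨a, ha⟩ := exists_eq_two_pow hp1 hrec n
  obtain ⟨b, hb⟩ := exists_eq_two_pow hp1 hrec (n + 1)
  rw [ha, hb, ← pow_succ'] at h ⊢
  exact pow_dvd_pow _ ((Nat.pow_le_pow_iff_right Nat.one_lt_two).1 h)

lemma succ_le_seq {p : ℕ → ℕ} (hp1 : p 1 = 1)
    (hrec : ∀ n : ℕ, 1 ≤ n → p (n + 1) = 2 ^ (n ^ p n)) (n : ℕ) :
    n + 1 ≤ p (n + 1) := by
  induction n with
  | zero => simp [hp1]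
  | succ n ih => have := two_mul_le_succ hp1 hrec n; change _ ≤ p (n + 2); omega

lemma two_pow_mul_le_add {p : ℕ → ℕ} (hp1 : p 1 = 1)
    (hrec : ∀ n : ℕ, 1 ≤ n → p (n + 1) = 2 ^ (n ^ p n)) (n j : ℕ) :
    2 ^ j * p (n + 1) ≤ p (j + n + 1) := by
  induction j with
  | zero => simp
  | succ j ih =>
    have := two_mul_le_succ hp1 hrec (j + n)
    rw [show j + 1 + n + 1 = j + n + 2 by ring, pow_succ']
    linarith

lemma exists_odd_partial_sum {p : ℕ → ℕ} (hp1 : p 1 = 1)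
    (hrec : ∀ n : ℕ, 1 ≤ n → p (n + 1) = 2 ^ (n ^ p n)) (n : ℕ) :
    ∃ M : ℕ, (p (n + 1) : ℝ) * ∑ k ∈ Finset.range (n + 1), (1 : ℝ) / p (k + 1) = 2 * M + 1 := by
  induction n with
  | zero => exact ⟨0, by simp [hp1]⟩
  | succ n ih =>
    obtain ⟨M, hM⟩ := ih
    obtain ⟨c, hc⟩ := two_mul_dvd_succ hp1 hrec n
    have h0 : (p (n + 1 + 1) : ℝ) ≠ 0 := by
      have := succ_le_seq hp1 hrec (n + 1)
      exact_mod_cast (show p (n + 1 + 1) ≠ 0 by omega)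
    refine ⟨c * (2 * M + 1), ?_⟩
    rw [Finset.sum_range_succ, mul_add, mul_one_div_cancel h0]
    have hc' : (p (n + 1 + 1) : ℝ) = 2 * p (n + 1) * c := by exact_mod_cast hc
    rw [hc']
    push_cast
    linear_combination 2 * c * hM

/-- The numbers `p n * θ` approximate odd integers from above, to within `2 * p n / p (n + 1)`. -/
lemma exists_odd_approx {p : ℕ → ℕ} (hp1 : p 1 = 1)
    (hrec : ∀ n : ℕ, 1 ≤ n → p (n + 1) = 2 ^ (n ^ p n))
    {θ : ℝ} (hθ : θ = ∑' n : ℕ, (1 : ℝ) / p (n + 1)) (n : ℕ) :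
    ∃ (M : ℕ) (ε : ℝ), 0 < ε ∧ ε ≤ 2 * p (n + 1) / p (n + 2) ∧
      p (n + 1) * θ = 2 * M + 1 + ε := by
  have hpos : ∀ n, (0 : ℝ) < p (n + 1) := fun n => by
    have := succ_le_seq hp1 hrec n
    exact_mod_cast (show 0 < p (n + 1) by omega)
  have hb : ∀ n j, (1 : ℝ) / p (j + n + 1) ≤ 1 / p (n + 1) * (1 / 2) ^ j := fun n j => by
    have h : (2 : ℝ) ^ j * p (n + 1) ≤ p (j + n + 1) := by
      exact_mod_cast two_pow_mul_le_add hp1 hrec n j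
    calc (1 : ℝ) / p (j + n + 1) ≤ 1 / (2 ^ j * p (n + 1)) :=
          one_div_le_one_div_of_le (mul_pos (by positivity) (hpos n)) h
      _ = _ := by rw [one_div_pow, one_div_mul_one_div, mul_comm]
  have hgeo : ∀ n, HasSum (fun j : ℕ => (1 : ℝ) / p (n + 1) * (1 / 2) ^ j)
      (1 / p (n + 1) * 2) := fun n => hasSum_geometric_two.mul_left _
  have hs : Summable (fun n : ℕ => (1 : ℝ) / p (n + 1)) :=
    Summable.of_nonneg_of_le (fun j => (one_div_pos.2 (hpos j)).le) (hb 0) (hgeo 0).summable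
  have hs' : Summable (fun j : ℕ => (1 : ℝ) / p (j + (n + 1) + 1)) :=
    (summable_nat_add_iff (n + 1)).2 hs
  obtain ⟨M, hM⟩ := exists_odd_partial_sum hp1 hrec n
  refine ⟨M, p (n + 1) * ∑' j : ℕ, (1 : ℝ) / p (j + (n + 1) + 1), ?_, ?_, ?_⟩
  · exact mul_pos (hpos n) (hs'.tsum_pos (fun j => (one_div_pos.2 (hpos _)).le) 0
      (one_div_pos.2 (hpos _)))
  · have := (hs'.tsum_le_tsum (hb (n + 1)) (hgeo (n + 1)).summable).trans_eq (hgeo (n + 1)).tsum_eq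
    calc _ ≤ (p (n + 1) : ℝ) * (1 / p (n + 1 + 1) * 2) :=
          mul_le_mul_of_nonneg_left this (hpos n).le
      _ = _ := by ring
  · rw [hθ, ← hs.sum_add_tsum_nat_add (n + 1), mul_add, hM]

lemma sq_le_succ {p : ℕ → ℕ} (hp1 : p 1 = 1)
    (hrec : ∀ n : ℕ, 1 ≤ n → p (n + 1) = 2 ^ (n ^ p n)) (n : ℕ) :
    p (n + 1) ^ 2 ≤ p (n + 2) := by
  rcases n with _ | n
  · simpa [hp1] using (succ_le_seq hp1 hrec 1).trans' one_le_two
  · rw [hrec (n + 2) (by omega)]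
    set m := p (n + 1 + 1)
    have h1 : m < 2 ^ m := Nat.lt_two_pow_self
    have h2 : m * 2 ≤ 2 ^ m := by
      rcases m with _ | m
      · simp
      · have : m < 2 ^ m := Nat.lt_two_pow_self
        rw [pow_succ]; omega
    have h3 : 2 ^ m ≤ (n + 2) ^ m := Nat.pow_le_pow_left (by omega) _
    calc m ^ 2 ≤ (2 ^ m) ^ 2 := Nat.pow_le_pow_left h1.le _
      _ = 2 ^ (m * 2) := (pow_mul _ _ _).symm
      _ ≤ _ := Nat.pow_le_pow_right (by norm_num) (h2.trans h3)

lemma exp_zpow_ne_neg_one {p : ℕ → ℕ} (hp1 : p 1 = 1)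
    (hrec : ∀ n : ℕ, 1 ≤ n → p (n + 1) = 2 ^ (n ^ p n))
    {θ : ℝ} (hθ : θ = ∑' n : ℕ, (1 : ℝ) / p (n + 1)) (k : ℤ) :
    Complex.exp (Real.pi * Complex.I * (θ : ℂ)) ^ k ≠ -1 := by
  intro h
  rw [← Complex.exp_int_mul, ← Complex.exp_pi_mul_I, Complex.exp_eq_exp_iff_exists_int] at h
  obtain ⟨j, hj⟩ := h
  have hπ : (Real.pi : ℂ) * Complex.I ≠ 0 :=
    mul_ne_zero (by exact_mod_cast Real.pi_ne_zero) Complex.I_ne_zero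
  have hk : (k : ℝ) * θ = 1 + 2 * j := by
    have : (k : ℂ) * θ = 1 + 2 * j := mul_left_cancel₀ hπ (by linear_combination hj)
    exact_mod_cast this
  have hk0 : k ≠ 0 := by
    rintro rfl
    rw [Int.cast_zero, zero_mul] at hk
    have : (0 : ℤ) = 1 + 2 * j := by exact_mod_cast hk
    omega
  obtain ⟨M, ε, hε, hε', h⟩ := exists_odd_approx hp1 hrec hθ (2 * k.natAbs)
  set n := 2 * k.natAbs
  have hn := succ_le_seq hp1 hrec n
  have hsq : (p (n + 1) : ℝ) ^ 2 ≤ p (n + 2) := by exact_mod_cast sq_le_succ hp1 hrec n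
  have hpos : (0 : ℝ) < p (n + 1) := by exact_mod_cast (show 0 < p (n + 1) by omega)
  have hint : (k : ℝ) * ε = ((1 + 2 * j) * p (n + 1) - k * (2 * M + 1) : ℤ) := by
    push_cast
    linear_combination (p (n + 1) : ℝ) * hk - k * h
  have hlt : |(k : ℝ) * ε| < 1 := by
    have hka : (2 : ℝ) * |(k : ℝ)| < p (n + 1) := by
      have : 2 * (k.natAbs : ℝ) < p (n + 1) := by exact_mod_cast (show n < p (n + 1) by omega)
      simpa [Nat.cast_natAbs] using this
    rw [abs_mul, abs_of_pos hε]
    have h2 : ε ≤ 2 / p (n + 1) := by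
      refine hε'.trans ?_
      rw [div_le_div_iff₀ (by nlinarith) hpos]
      nlinarith
    rw [le_div_iff₀ hpos] at h2
    nlinarith [abs_nonneg (k : ℝ)]
  rw [hint] at hlt
  have : ((1 + 2 * j) * p (n + 1) - k * (2 * M + 1) : ℤ) = 0 :=
    Int.abs_lt_one_iff.1 (by exact_mod_cast hlt)
  rw [this] at hint
  exact mul_ne_zero (Int.cast_ne_zero.2 hk0) hε.ne' (hint.trans Int.cast_zero)

lemma norm_exp_pow_add_one_le {p : ℕ → ℕ} (hp1 : p 1 = 1)
    (hrec : ∀ n : ℕ, 1 ≤ n → p (n + 1) = 2 ^ (n ^ p n))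
    {θ : ℝ} (hθ : θ = ∑' n : ℕ, (1 : ℝ) / p (n + 1)) (n : ℕ) :
    ‖1 + Complex.exp (Real.pi * Complex.I * (θ : ℂ)) ^ p (n + 1)‖ ≤
      Real.pi * (2 * p (n + 1) / p (n + 2)) := by
  obtain ⟨M, ε, hε, hε', h⟩ := exists_odd_approx hp1 hrec hθ n
  have h' : (p (n + 1) : ℂ) * θ = 2 * M + 1 + ε := by exact_mod_cast h
  have : Complex.exp (Real.pi * Complex.I * (θ : ℂ)) ^ p (n + 1) =
      -Complex.exp (Complex.I * (Real.pi * ε : ℝ)) := by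
    rw [← Complex.exp_nat_mul, show (p (n + 1) : ℂ) * (Real.pi * Complex.I * θ) =
      M * (2 * Real.pi * Complex.I) + (Real.pi * Complex.I + Complex.I * (Real.pi * ε : ℝ)) by
        push_cast; linear_combination (Real.pi * Complex.I) * h',
      Complex.exp_add, Complex.exp_add, Complex.exp_nat_mul_two_pi_mul_I, Complex.exp_pi_mul_I]
    ring
  rw [this, ← sub_eq_add_neg, norm_sub_rev]
  refine (Real.norm_exp_I_mul_ofReal_sub_one_le).trans ?_
  rw [Real.norm_of_nonneg (by positivity)]
  gcongr

lemma exists_mul_lt_succ {p : ℕ → ℕ} (hp1 : p 1 = 1)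
    (hrec : ∀ n : ℕ, 1 ≤ n → p (n + 1) = 2 ^ (n ^ p n)) (D R : ℝ) (hR : 0 ≤ R) :
    ∃ n, D * p (n + 1) * R ^ p (n + 1) < p (n + 2) := by
  obtain ⟨n, hn⟩ := exists_nat_gt (max (max |D| R) 4)
  simp only [max_lt_iff] at hn
  obtain ⟨⟨hD, hRn⟩, h4⟩ := hn
  refine ⟨n, ?_⟩
  rw [hrec (n + 1) (by omega)]
  have hm := succ_le_seq hp1 hrec n
  obtain ⟨m, hm'⟩ : ∃ m, p (n + 1) = m + 1 := ⟨p (n + 1) - 1, by omega⟩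
  rw [hm']
  have hsq : ∀ x : ℕ, 5 ≤ x → x ^ 2 < 2 ^ x := fun x hx => by
    induction x, hx using Nat.le_induction with
    | base => norm_num
    | succ x hx ih => rw [pow_succ 2 x]; nlinarith
  have h4' : 4 < n := by exact_mod_cast h4
  have hbig : ((n + 1) ^ (m + 1)) ^ 2 < 2 ^ ((n + 1) ^ (m + 1)) :=
    hsq _ ((by omega : 5 ≤ n + 1).trans (Nat.le_self_pow (by omega) _))
  have h1 : (m : ℝ) + 1 ≤ (n + 1) ^ m := by
    have : m < (n + 1) ^ m := Nat.lt_pow_self (by omega)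
    exact_mod_cast this
  have h2 : R ^ (m + 1) ≤ ((n : ℝ) + 1) ^ (m + 1) := by gcongr; linarith
  have h3 : D * (m + 1) < ((n : ℝ) + 1) ^ (m + 1) := by
    have : D < n + 1 := by linarith [le_abs_self D]
    calc D * (m + 1) < (n + 1) * (m + 1) := by gcongr
      _ ≤ (n + 1) * (n + 1) ^ m := by gcongr
      _ = _ := (pow_succ' _ _).symm
  have h5 : (0 : ℝ) < ((n : ℝ) + 1) ^ (m + 1) := by positivity
  have h6 : (0 : ℝ) ≤ R ^ (m + 1) := by positivity
  have hbig' : (((n : ℝ) + 1) ^ (m + 1)) ^ 2 < 2 ^ ((n + 1) ^ (m + 1)) := by exact_mod_cast hbig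
  push_cast
  calc D * ((m : ℝ) + 1) * R ^ (m + 1) ≤ ((n : ℝ) + 1) ^ (m + 1) * R ^ (m + 1) := by gcongr
    _ ≤ ((n : ℝ) + 1) ^ (m + 1) * ((n : ℝ) + 1) ^ (m + 1) := by gcongr
    _ < _ := by rwa [← sq]

open MeasureTheory AddCircle in
lemma fourierCoeff_comp_add_right {T : ℝ} [Fact (0 < T)] (f : AddCircle T → ℂ) (b : AddCircle T)
    (n : ℤ) : fourierCoeff (fun t => f (t + b)) n = (toCircle b : ℂ) ^ n * fourierCoeff f n := by
  have h := integral_add_right_eq_self (μ := haarAddCircle)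
    (fun t : AddCircle T => (toCircle b : ℂ) ^ n * (fourier (-n) t * f t)) b
  refine (integral_congr_ae (.of_forall fun t => ?_)).trans (h.trans (integral_const_mul _ _))
  have hb : (toCircle b : ℂ) ≠ 0 := (toCircle b).coe_ne_zero
  simp only [smul_eq_mul, fourier_apply, toCircle_zsmul, toCircle_add, mul_zpow, zpow_neg,
    Circle.coe_inv, Circle.coe_mul, Circle.coe_zpow]
  field_simp

open MeasureTheory AddCircle in
lemma fourierCoeff_toCircle_mul {T : ℝ} [Fact (0 < T)] (f : AddCircle T → ℂ) (n : ℤ) :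
    fourierCoeff (fun t => (toCircle t : ℂ) * f t) n = fourierCoeff f (n - 1) := by
  refine integral_congr_ae (.of_forall fun t => ?_)
  simp only [smul_eq_mul]
  rw [← fourier_one, ← mul_assoc, ← fourier_add]
  ring_nf

open MeasureTheory AddCircle in
lemma norm_fourierCoeff_le {T : ℝ} [Fact (0 < T)] (f : C(AddCircle T, ℂ)) (n : ℤ) :
    ‖fourierCoeff f n‖ ≤ ‖f‖ := by
  refine (norm_integral_le_of_norm_le_const (C := ‖f‖) (.of_forall fun t => ?_)).trans_eq
    (by simp)
  rw [norm_smul, fourier_apply, Circle.norm_coe, one_mul]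
  exact f.norm_coe_le_norm t

lemma ContinuousMap.integrable_haarAddCircle {T : ℝ} [Fact (0 < T)] (f : C(AddCircle T, ℂ)) :
    MeasureTheory.Integrable f AddCircle.haarAddCircle :=
  f.continuous.integrable_of_hasCompactSupport (HasCompactSupport.of_compactSpace _)

lemma fourierCoeff_comp_add_right_add {T : ℝ} [Fact (0 < T)] (f : C(AddCircle T, ℂ))
    (b : AddCircle T) (n : ℤ) : fourierCoeff (fun t => f (t + b) + f t) n =
      (1 + (AddCircle.toCircle b : ℂ) ^ n) * fourierCoeff f n := by
  have h := congrFun (fourierCoeff.add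
    (f.comp ⟨(· + b), continuous_add_const b⟩).integrable_haarAddCircle
    f.integrable_haarAddCircle) n
  refine h.trans ?_
  have h' := fourierCoeff_comp_add_right f b n
  rw [Pi.add_apply, add_mul, one_mul, add_comm]
  exact congrArg _ h'

lemma eq_zero_of_fourierCoeff_eq_zero {T : ℝ} [Fact (0 < T)] {f : C(AddCircle T, ℂ)}
    (h : ∀ n, fourierCoeff f n = 0) : f = 0 := by
  have hs : Summable (fourierCoeff f) := by
    rw [funext h]
    exact summable_zero
  refine (hasSum_fourier_series_of_summable hs).unique ?_
  simp [h]

/-- The positive Fourier coefficients of `z / (R - z)` on the unit circle are those of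
`∑ k ≥ 1, (z / R) ^ k`. -/
lemma fourierCoeff_div_sub {T : ℝ} [Fact (0 < T)] {R : ℝ} (hR : 1 < R) {g : C(AddCircle T, ℂ)}
    (hg : ∀ t, ((R : ℂ) - AddCircle.toCircle t) * g t = AddCircle.toCircle t) (n : ℕ) :
    fourierCoeff g (n + 1) = ((R : ℂ) ^ (n + 1))⁻¹ := by
  have hR0 : (R : ℂ) ≠ 0 := by exact_mod_cast (by linarith : R ≠ 0)
  have hrec : ∀ k : ℤ, (R : ℂ) * fourierCoeff g k =
      fourierCoeff g (k - 1) + if k = 1 then 1 else 0 := fun k => by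
    have hc : (fun t => (R : ℂ) * g t) =
        (fun t => (AddCircle.toCircle t : ℂ) * g t) + fourier (T := T) 1 := by
      funext t
      simp only [Pi.add_apply, fourier_one]
      linear_combination hg t
    rw [← fourierCoeff.const_mul, hc, fourierCoeff.add, Pi.add_apply, fourierCoeff_toCircle_mul,
      fourierCoeff_fourier]
    · simp [Pi.single_apply]
    · have := (fourier (T := T) 1 * g).integrable_haarAddCircle
      simpa [fourier_one, ContinuousMap.coe_mul, Pi.mul_def] using this
    · exact (fourier (T := T) 1).integrable_haarAddCircle
  have hneg : ∀ m : ℕ, fourierCoeff g (-m) = (R : ℂ) ^ m * fourierCoeff g 0 := fun m => by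
    induction m with
    | zero => simp
    | succ m ih =>
      have h := hrec (-m)
      rw [if_neg (by omega), add_zero] at h
      rw [Nat.cast_succ, neg_add', ← h, ih, pow_succ', mul_assoc]
  have h0 : fourierCoeff g 0 = 0 := by
    have hle : ∀ m : ℕ, R ^ m * ‖fourierCoeff g 0‖ ≤ ‖g‖ := fun m => by
      have h := norm_fourierCoeff_le g (-m)
      rwa [hneg, norm_mul, norm_pow, norm_real, Real.norm_of_nonneg (by linarith)] at h
    by_contra hne
    obtain ⟨m, hm⟩ := pow_unbounded_of_one_lt (‖g‖ / ‖fourierCoeff g 0‖) hR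
    rw [div_lt_iff₀ (norm_pos_iff.2 hne)] at hm
    exact hm.not_ge (hle m)
  induction n with
  | zero =>
    have h := hrec 1
    simp only [sub_self, h0, if_true, zero_add] at h
    simpa using eq_inv_of_mul_eq_one_right h
  | succ n ih =>
    have h := hrec (n + 1 + 1)
    rw [if_neg (by omega), add_zero, add_sub_cancel_right, ih] at h
    rw [Nat.cast_succ, pow_succ (R : ℂ) (n + 1), mul_inv, ← h]
    field_simp

/-- The restriction of a function on the annulus to the circle of radius `r`. -/
noncomputable def circleRestriction {f : ℂ → ℂ} {R r : ℝ} (hf : ContinuousOn f (ann R))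
    (hr : r ∈ Ioo (1 / R) R) (hr0 : 0 ≤ r) : C(AddCircle (1 : ℝ), ℂ) where
  toFun t := f (r * AddCircle.toCircle t)
  continuous_toFun := hf.comp_continuous (by fun_prop) fun t => by
    simpa [ann, abs_of_nonneg hr0, Circle.norm_coe] using hr

lemma toCircle_coe_half (θ : ℝ) :
    (AddCircle.toCircle ((θ / 2 : ℝ) : AddCircle (1 : ℝ)) : ℂ) =
      Complex.exp (Real.pi * Complex.I * (θ : ℂ)) := by
  rw [AddCircle.toCircle_apply_mk, Circle.coe_exp]
  push_cast
  ring_nf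

lemma exists_norm_mul_toCircle_eq (z : ℂ) :
    ∃ t : AddCircle (1 : ℝ), (‖z‖ : ℂ) * AddCircle.toCircle t = z := by
  refine ⟨((arg z / Real.pi / 2 : ℝ) : AddCircle (1 : ℝ)), ?_⟩
  rw [toCircle_coe_half]
  nth_rewrite 3 [← norm_mul_exp_arg_mul_I z]
  have hπ : (Real.pi : ℂ) ≠ 0 := by exact_mod_cast Real.pi_ne_zero
  congr 2
  push_cast
  field_simp

/-- With `p₁ = 1`, `p_{n+1} = 2^(n^{pₙ})`, `θ = Σ_{n≥1} 1/pₙ` and `β = e^{iπθ}`, the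
equation `f(βz) + f(z) = z/(R − z)` has no holomorphic solution on `𝔸`; hence `−1` is in
the spectrum of the rotation operator `(Tf)(z) = f(βz)`, although `−1` is not an
eigenvalue of `T`. -/
theorem stmt19 (R : ℝ) (hR : 1 < R) (p : ℕ → ℕ) (hp1 : p 1 = 1)
    (hrec : ∀ n : ℕ, 1 ≤ n → p (n + 1) = 2 ^ (n ^ p n))
    (θ : ℝ) (hθ : θ = ∑' n : ℕ, (1 : ℝ) / p (n + 1))
    (β : ℂ) (hβ : β = Complex.exp (Real.pi * Complex.I * (θ : ℂ))) :
    (¬ ∃ f : ℂ → ℂ, DifferentiableOn ℂ f (ann R) ∧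
        ∀ z ∈ ann R, f (β * z) + f z = z / (R - z)) ∧
    (¬ ∃ f : ℂ → ℂ, DifferentiableOn ℂ f (ann R) ∧ (∃ z ∈ ann R, f z ≠ 0) ∧
        ∀ z ∈ ann R, f (β * z) = - f z) := by
  have hb := toCircle_coe_half θ
  rw [← hβ] at hb
  set b : AddCircle (1 : ℝ) := ((θ / 2 : ℝ) : AddCircle (1 : ℝ))
  have hshift : ∀ (r : ℝ) (t : AddCircle (1 : ℝ)),
      (r : ℂ) * AddCircle.toCircle (t + b) = β * (r * AddCircle.toCircle t) := fun r t => by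
    rw [AddCircle.toCircle_add, Circle.coe_mul, hb]
    ring
  have hmem : ∀ {r : ℝ}, r ∈ Ioo (1 / R) R → 0 ≤ r → ∀ t : AddCircle (1 : ℝ),
      (r : ℂ) * AddCircle.toCircle t ∈ ann R := fun hr hr0 t => by
    simpa [ann, abs_of_nonneg hr0, Circle.norm_coe] using hr
  constructor
  · rintro ⟨f, hf, hfg⟩
    have h1 : (1 : ℝ) ∈ Ioo (1 / R) R := ⟨(div_lt_one (by linarith)).2 hR, hR⟩
    set F := circleRestriction hf.continuousOn h1 zero_le_one
    have hG : ∀ t, ((R : ℂ) - AddCircle.toCircle t) * (F (t + b) + F t) =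
        AddCircle.toCircle t := fun t => by
      have hne : (R : ℂ) - AddCircle.toCircle t ≠ 0 := fun h => by
        have := congrArg norm (sub_eq_zero.1 h)
        rw [Circle.norm_coe, norm_real, Real.norm_of_nonneg (by linarith)] at this
        linarith
      have h := hfg _ (hmem h1 zero_le_one t)
      rw [← hshift] at h
      change F (t + b) + F t = _ at h
      rw [h, ofReal_one, one_mul, mul_div_cancel₀ _ hne]
    obtain ⟨n, hn⟩ := exists_mul_lt_succ hp1 hrec (2 * Real.pi * ‖F‖) R (by linarith)
    have hm := succ_le_seq hp1 hrec n
    have hm2 := succ_le_seq hp1 hrec (n + 1)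
    have hcoeff : (1 + β ^ p (n + 1)) * fourierCoeff F (p (n + 1)) =
        ((R : ℂ) ^ p (n + 1))⁻¹ := by
      obtain ⟨m, hm'⟩ : ∃ m, p (n + 1) = m + 1 := ⟨p (n + 1) - 1, by omega⟩
      have h := fourierCoeff_div_sub hR (g := ⟨fun t => F (t + b) + F t, by fun_prop⟩) hG m
      rw [ContinuousMap.coe_mk, fourierCoeff_comp_add_right_add, hb] at h
      rw [hm']
      exact_mod_cast h
    have hR0 : (0 : ℝ) < R ^ p (n + 1) := by positivity
    have hp2 : (0 : ℝ) < p (n + 2) := by exact_mod_cast (by omega : 0 < p (n + 1 + 1))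
    have hnorm := congrArg norm hcoeff
    rw [norm_mul, norm_inv, norm_pow, norm_real, Real.norm_of_nonneg (by linarith)] at hnorm
    have hle : (R ^ p (n + 1))⁻¹ ≤ Real.pi * (2 * p (n + 1) / p (n + 2)) * ‖F‖ := by
      rw [← hnorm]
      gcongr
      · rw [hβ]
        exact norm_exp_pow_add_one_le hp1 hrec hθ n
      · exact norm_fourierCoeff_le F _
    rw [inv_le_iff_one_le_mul₀ hR0] at hle
    have : (p (n + 2) : ℝ) ≤ 2 * Real.pi * ‖F‖ * p (n + 1) * R ^ p (n + 1) := by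
      calc (p (n + 2) : ℝ) ≤ p (n + 2) *
            (Real.pi * (2 * p (n + 1) / p (n + 2)) * ‖F‖ * R ^ p (n + 1)) :=
            le_mul_of_one_le_right hp2.le hle
        _ = _ := by field_simp
    linarith
  · rintro ⟨f, hf, ⟨z, hz, hfz⟩, hfe⟩
    set F := circleRestriction hf.continuousOn hz (norm_nonneg z)
    have hG : (fun t => F (t + b) + F t) = fun _ => 0 := funext fun t => by
      have h := hfe _ (hmem hz (norm_nonneg z) t)
      rw [← hshift] at h
      exact eq_neg_iff_add_eq_zero.1 h
    have hF : F = 0 := eq_zero_of_fourierCoeff_eq_zero fun n => by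
      have h := fourierCoeff_comp_add_right_add F b n
      rw [hG, hb] at h
      have h0 : (1 + β ^ n) * fourierCoeff F n = 0 := by simpa [fourierCoeff] using h.symm
      refine (mul_eq_zero.1 h0).resolve_left fun h => ?_
      refine exp_zpow_ne_neg_one hp1 hrec hθ n ?_
      rw [← hβ]
      linear_combination h
    obtain ⟨t, ht⟩ := exists_norm_mul_toCircle_eq z
    have hFt : f (‖z‖ * AddCircle.toCircle t) = 0 := congrArg (fun G => G t) hF
    exact hfz (ht ▸ hFt)
end
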